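/- Let k ≥ 2, let Ω be a Runge Fatou–Bieberbach domain in ℂ^k, and let p ∈ Ω. Then there exist ρ > 0, real numbers 0 < s < r < 1 with r² < s, and a sequence (φ_j)_{j ≥ 1} of holomorphic automorphisms of ℂ^k with φ_j(p) = p and s‖z − p‖ ≤ ‖φ_j(z) − p‖ ≤ r‖z − p‖ for all z in the open ball B_ρ(p) and all j, such that Ω equals the basin of attraction Ω^p_{(φ_j)} = {z ∈ ℂ^k : φ_j ∘ ⋯ ∘ φ_1 (z) → p as j → ∞}. -/

import Mathlib

open Metric Set Filter

noncomputable section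

/-- A Fatou–Bieberbach domain in `ℂ^k`: an open set `Ω ≠ ℂ^k` which is the range of an
injective entire map `ℂ^k → ℂ^k`. -/
def IsFBDomain {k : ℕ} (Ω : Set (EuclideanSpace ℂ (Fin k))) : Prop :=
  IsOpen Ω ∧ Ω ≠ Set.univ ∧
    ∃ F : EuclideanSpace ℂ (Fin k) → EuclideanSpace ℂ (Fin k),
      Differentiable ℂ F ∧ Function.Injective F ∧ Set.range F = Ω

/-- A holomorphic automorphism of `ℂ^k`: a holomorphic bijection with holomorphic inverse. -/
def IsAutomorphism {k : ℕ} (F : EuclideanSpace ℂ (Fin k) → EuclideanSpace ℂ (Fin k)) : Prop :=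
  Differentiable ℂ F ∧ ∃ G : EuclideanSpace ℂ (Fin k) → EuclideanSpace ℂ (Fin k),
    Differentiable ℂ G ∧ Function.LeftInverse G F ∧ Function.RightInverse G F

/-- An open set `Ω ⊆ ℂ^k` is Runge if every function holomorphic on `Ω` can be approximated
uniformly on compact subsets of `Ω` by polynomials. -/
def IsRunge {k : ℕ} (Ω : Set (EuclideanSpace ℂ (Fin k))) : Prop :=
  ∀ f : EuclideanSpace ℂ (Fin k) → ℂ, DifferentiableOn ℂ f Ω →
    ∀ K ⊆ Ω, IsCompact K → ∀ ε > (0 : ℝ),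
      ∃ P : MvPolynomial (Fin k) ℂ,
        ∀ z ∈ K, ‖f z - MvPolynomial.eval (fun i => z i) P‖ < ε

/-- `seqComp F j = F j ∘ ⋯ ∘ F 1`, with `seqComp F 0 = id`. -/
def seqComp {α : Type*} (F : ℕ → α → α) : ℕ → α → α
  | 0 => id
  | n + 1 => F (n + 1) ∘ seqComp F n

open Metric Set Filter Topology
section P1
variable {E F : Type*} [NormedAddCommGroup E] [NormedSpace ℂ E] [NormedAddCommGroup F]
  [NormedSpace ℂ F]

/-- Cauchy estimate. -/
lemma cauchy_est {f : E → F} {c : E} {R M : ℝ} (hR : 0 < R)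
    (hf : DifferentiableOn ℂ f (ball c R)) (hM : ∀ z ∈ ball c R, ‖f z‖ ≤ M) :
    ‖fderiv ℂ f c‖ ≤ 2 * M / R := by
  refine Complex.norm_fderiv_le_div_of_mapsTo_ball hf (fun z hz => ?_) hR
  rw [mem_closedBall, dist_eq_norm]
  have h1 := hM z hz
  have h2 := hM c (mem_ball_self hR)
  linarith [norm_sub_le (f z) (f c)]

/-- Holomorphic functions have continuous derivative. -/
lemma hol_fderiv_continuousOn [ProperSpace E] {f : E → F} {U : Set E} (hU : IsOpen U)
    (hf : DifferentiableOn ℂ f U) : ContinuousOn (fderiv ℂ f) U := by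
  intro a ha
  refine ContinuousAt.continuousWithinAt ?_
  obtain ⟨r, hr, hrU⟩ : ∃ r > 0, closedBall a (3 * r) ⊆ U := by
    obtain ⟨ε, hε, h⟩ := Metric.nhds_basis_closedBall.mem_iff.1 (hU.mem_nhds ha)
    exact ⟨ε / 3, by positivity, by convert h using 2; ring⟩
  have huc : UniformContinuousOn f (closedBall a (3 * r)) :=
    (isCompact_closedBall a (3 * r)).uniformContinuousOn_of_continuous
      (hf.continuousOn.mono hrU)
  rw [Metric.continuousAt_iff]
  intro ε hε
  obtain ⟨δ, hδ, hδ'⟩ := Metric.uniformContinuousOn_iff.1 huc (ε * r / 4) (by positivity)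
  refine ⟨min δ r, by positivity, fun {b} hb => ?_⟩
  have hbr : dist b a < r := lt_of_lt_of_le hb (min_le_right _ _)
  have hbδ : dist b a < δ := lt_of_lt_of_le hb (min_le_left _ _)
  set g : E → F := fun z => f (z + (b - a)) - f z with hg
  have hnb : ‖b - a‖ < r := by rwa [← dist_eq_norm]
  have hm1 : ∀ z ∈ ball a r, z ∈ closedBall a (3 * r) := fun z hz => by
    rw [mem_ball] at hz; rw [mem_closedBall]; linarith
  have hm2 : ∀ z ∈ ball a r, z + (b - a) ∈ closedBall a (3 * r) := fun z hz => by
    rw [mem_ball, dist_eq_norm] at hz; rw [mem_closedBall, dist_eq_norm]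
    have : z + (b - a) - a = (z - a) + (b - a) := by abel
    rw [this]; linarith [norm_add_le (z - a) (b - a)]
  have hdf : ∀ z ∈ closedBall a (3 * r), DifferentiableAt ℂ f z := fun z hz =>
    (hf z (hrU hz)).differentiableAt (hU.mem_nhds (hrU hz))
  have hgd : DifferentiableOn ℂ g (ball a r) := by
    intro z hz
    refine DifferentiableAt.differentiableWithinAt ?_
    refine DifferentiableAt.sub ?_ (hdf z (hm1 z hz))
    exact (hdf _ (hm2 z hz)).comp z (by fun_prop)
  have hest := cauchy_est hr hgd (M := ε * r / 4) (fun z hz => by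
    have := hδ' _ (hm2 z hz) _ (hm1 z hz) (by simpa [dist_eq_norm] using hbδ)
    rw [dist_eq_norm] at this; exact this.le)
  have haa : a ∈ ball a r := mem_ball_self hr
  have hfd : fderiv ℂ g a = fderiv ℂ f b - fderiv ℂ f a := by
    rw [hg]
    have h1 : DifferentiableAt ℂ (fun z => f (z + (b - a))) a :=
      (hdf _ (hm2 a haa)).comp a (by fun_prop)
    have := fderiv_sub h1 (hdf a (hm1 a haa))
    rw [show (fun z => f (z + (b - a)) - f z) = (fun z => f (z + (b - a))) - f from rfl, this,
      fderiv_comp_add_right]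
    simp
  rw [hfd] at hest
  rw [dist_eq_norm]
  calc _ ≤ 2 * (ε * r / 4) / r := hest
    _ = ε / 2 := by field_simp; ring
    _ < ε := by linarith

/-- Uniform limits of holomorphic functions. -/
lemma hol_limit [CompleteSpace F] {f : ℕ → E → F} {g : E → F} {a : E} {r : ℝ} (hr : 0 < r)
    (hf : ∀ n, DifferentiableOn ℂ (f n) (ball a r))
    (hg : TendstoUniformlyOn f g atTop (ball a r)) : DifferentiableAt ℂ g a := by
  have hsub : ∀ x ∈ ball a (r / 2), ball x (r / 2) ⊆ ball a r := fun x hx =>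
    ball_subset_ball' (by rw [mem_ball] at hx; linarith)
  have hsub' : ∀ x ∈ ball a (r / 2), x ∈ ball a r := fun x hx =>
    ball_subset_ball (by linarith) hx
  have hd : ∀ n, ∀ x ∈ ball a r, DifferentiableAt ℂ (f n) x := fun n x hx =>
    (hf n x hx).differentiableAt (isOpen_ball.mem_nhds hx)
  have hC : UniformCauchySeqOn (fun n => fderiv ℂ (f n)) atTop (ball a (r / 2)) := by
    rw [Metric.uniformCauchySeqOn_iff]
    intro ε hε
    obtain ⟨N, hN⟩ := Metric.uniformCauchySeqOn_iff.1 hg.uniformCauchySeqOn (ε * r / 8)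
      (by positivity)
    refine ⟨N, fun m hm n hn x hx => ?_⟩
    have h1 := cauchy_est (f := fun z => f m z - f n z) (c := x) (R := r / 2) (M := ε * r / 8)
      (by positivity) (((hf m).mono (hsub x hx)).sub ((hf n).mono (hsub x hx)))
      (fun z hz => by
        have := hN m hm n hn z (hsub x hx hz)
        rw [dist_eq_norm] at this; exact this.le)
    have h2 := fderiv_sub (hd m x (hsub' x hx)) (hd n x (hsub' x hx))
    rw [show (fun z => f m z - f n z) = f m - f n from rfl, h2] at h1
    rw [dist_eq_norm]
    calc _ ≤ 2 * (ε * r / 8) / (r / 2) := h1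
      _ = ε / 2 := by field_simp; ring
      _ < ε := by linarith
  have hlim : ∀ x ∈ ball a (r / 2), ∃ L, Tendsto (fun n => fderiv ℂ (f n) x) atTop (𝓝 L) :=
    fun x hx => cauchySeq_tendsto_of_complete (hC.cauchySeq hx)
  choose! g' hg' using hlim
  have := hasFDerivAt_of_tendstoUniformlyOn (f := f) (g := g) (g' := g') isOpen_ball
    (hC.tendstoUniformlyOn_of_tendsto hg')
    (fun n x hx => (hd n x (hsub' x hx)).hasFDerivAt)
    (fun x hx => hg.tendsto_at (hsub' x hx)) (mem_ball_self (by positivity : 0 < r / 2))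
  exact this.differentiableAt

/-- Uniform difference quotient for `C^1` functions. -/
lemma hol_dirDeriv_differentiableOn [ProperSpace E] [CompleteSpace F] {f : E → F} {U : Set E}
    (hU : IsOpen U) (hf : DifferentiableOn ℂ f U) (v : E) :
    DifferentiableOn ℂ (fun z => fderiv ℂ f z v) U := by
  intro a ha
  refine DifferentiableAt.differentiableWithinAt ?_
  obtain ⟨r, hr, hrU⟩ : ∃ r > 0, closedBall a (3 * r) ⊆ U := by
    obtain ⟨ε, hε, h⟩ := Metric.nhds_basis_closedBall.mem_iff.1 (hU.mem_nhds ha)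
    exact ⟨ε / 3, by positivity, by convert h using 2; ring⟩
  have huc : UniformContinuousOn (fderiv ℂ f) (closedBall a (3 * r)) :=
    (isCompact_closedBall a (3 * r)).uniformContinuousOn_of_continuous
      ((hol_fderiv_continuousOn hU hf).mono hrU)
  have hdf : ∀ z ∈ closedBall a (3 * r), DifferentiableAt ℂ f z := fun z hz =>
    (hf z (hrU hz)).differentiableAt (hU.mem_nhds (hrU hz))
  obtain ⟨N, hN⟩ := exists_nat_gt (‖v‖ / r)
  set t : ℕ → ℂ := fun n => ((n + N + 1 : ℕ) : ℂ)⁻¹ with ht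
  have htn : ∀ n, ‖t n‖ = ((n + N + 1 : ℕ) : ℝ)⁻¹ := fun n => by
    rw [ht]; simp only [norm_inv, Complex.norm_natCast]
  have ht0 : ∀ n, t n ≠ 0 := fun n => by
    rw [ht]; exact inv_ne_zero (Nat.cast_ne_zero.2 (Nat.succ_ne_zero _))
  have htv : ∀ n, ‖t n • v‖ < r := fun n => by
    rw [norm_smul, htn, inv_mul_lt_iff₀ (by positivity)]
    have : (N : ℝ) ≤ ((n + N + 1 : ℕ) : ℝ) := by push_cast; linarith [(n.cast_nonneg : (0:ℝ) ≤ n)]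
    rw [div_lt_iff₀ hr] at hN
    nlinarith
  have httend : Tendsto (fun n => ‖t n • v‖) atTop (𝓝 0) := by
    have : Tendsto (fun n : ℕ => ((n + (N + 1) : ℕ) : ℝ)⁻¹) atTop (𝓝 0) :=
      (tendsto_inv_atTop_nhds_zero_nat (𝕜 := ℝ)).comp (tendsto_add_atTop_nat (N + 1))
    have h2 := this.mul_const ‖v‖
    rw [zero_mul] at h2
    refine h2.congr fun n => ?_
    rw [norm_smul, htn, add_assoc]
  refine hol_limit (f := fun n z => (t n)⁻¹ • (f (z + t n • v) - f z)) hr ?_ ?_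
  · intro n z hz
    have hz1 : z ∈ closedBall a (3 * r) := by
      rw [mem_ball] at hz; rw [mem_closedBall]; linarith
    have hz2 : z + t n • v ∈ closedBall a (3 * r) := by
      rw [mem_ball, dist_eq_norm] at hz; rw [mem_closedBall, dist_eq_norm]
      have : z + t n • v - a = (z - a) + t n • v := by abel
      rw [this]; linarith [norm_add_le (z - a) (t n • v), htv n]
    refine DifferentiableAt.differentiableWithinAt ?_
    refine DifferentiableAt.const_smul (DifferentiableAt.sub ?_ (hdf z hz1)) _
    exact (hdf _ hz2).comp z (by fun_prop)
  · rw [Metric.tendstoUniformlyOn_iff]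
    intro ε hε
    obtain ⟨δ, hδ, hδ'⟩ := Metric.uniformContinuousOn_iff.1 huc (ε / (2 * (‖v‖ + 1)))
      (by positivity)
    filter_upwards [httend.eventually_lt_const hδ] with n hn z hz
    have hz0 : ‖z - a‖ < r := by rwa [mem_ball, dist_eq_norm] at hz
    -- mean value on the ball around z
    have hball : ∀ y ∈ closedBall z ‖t n • v‖, y ∈ closedBall a (3 * r) := fun y hy => by
      rw [mem_closedBall, dist_eq_norm] at hy ⊢
      have : y - a = (y - z) + (z - a) := by abel
      rw [this]; linarith [norm_add_le (y - z) (z - a), htv n]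
    have hzc : z ∈ closedBall z ‖t n • v‖ := mem_closedBall_self (norm_nonneg _)
    have hzc' : z + t n • v ∈ closedBall z ‖t n • v‖ := by
      rw [mem_closedBall, dist_eq_norm, add_sub_cancel_left]
    have hmv := Convex.norm_image_sub_le_of_norm_fderiv_le' (𝕜 := ℂ) (f := f)
      (φ := fderiv ℂ f z) (C := ε / (2 * (‖v‖ + 1))) (fun y hy => hdf y (hball y hy))
      (fun y hy => by
        rw [← dist_eq_norm]
        refine (hδ' y (hball y hy) z (hball z hzc) ?_).le
        rw [mem_closedBall] at hy; linarith) (convex_closedBall z ‖t n • v‖) hzc hzc'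
    rw [add_sub_cancel_left, norm_smul] at hmv
    have heq : fderiv ℂ f z v - (t n)⁻¹ • (f (z + t n • v) - f z)
        = -((t n)⁻¹ • (f (z + t n • v) - f z - fderiv ℂ f z (t n • v))) := by
      rw [map_smul, smul_sub _ _ (t n • _), inv_smul_smul₀ (ht0 n)]; abel
    rw [dist_eq_norm, heq, norm_neg, norm_smul, norm_inv]
    have htpos : 0 < ‖t n‖ := norm_pos_iff.2 (ht0 n)
    rw [inv_mul_lt_iff₀ htpos]
    refine lt_of_le_of_lt hmv ?_
    have h3 : ε / (2 * (‖v‖ + 1)) * ‖v‖ < ε := by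
      rw [div_mul_eq_mul_div, div_lt_iff₀ (by positivity)]
      nlinarith [norm_nonneg v]
    nlinarith

lemma hol_fderiv_differentiableOn [FiniteDimensional ℂ E] [CompleteSpace F] {f : E → F}
    {U : Set E} (hU : IsOpen U) (hf : DifferentiableOn ℂ f U) :
    DifferentiableOn ℂ (fderiv ℂ f) U := by
  have : ProperSpace E := FiniteDimensional.proper ℂ E
  let d := Module.finrank ℂ E
  have hd : d = Module.finrank ℂ (Fin d → ℂ) := (Module.finrank_fin_fun ℂ).symm
  let e₁ := ContinuousLinearEquiv.ofFinrankEq hd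
  let e₂ := (e₁.arrowCongr (1 : F ≃L[ℂ] F)).trans (ContinuousLinearEquiv.piRing (Fin d))
  rw [← Function.id_comp (fderiv ℂ f), ← e₂.symm_comp_self]
  exact e₂.symm.differentiable.comp_differentiableOn (differentiableOn_pi.2 fun i =>
    hol_dirDeriv_differentiableOn hU hf _)

lemma hol_strict [FiniteDimensional ℂ E] {f : E → F} {U : Set E} (hU : IsOpen U)
    (hf : DifferentiableOn ℂ f U) {a : E} (ha : a ∈ U) :
    HasStrictFDerivAt f (fderiv ℂ f a) a := by
  have : ProperSpace E := FiniteDimensional.proper ℂ E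
  refine hasStrictFDerivAt_of_hasFDerivAt_of_continuousAt (f' := fderiv ℂ f) ?_
    ((hol_fderiv_continuousOn hU hf).continuousAt (hU.mem_nhds ha))
  filter_upwards [hU.mem_nhds ha] with y hy
  exact ((hf y hy).differentiableAt (hU.mem_nhds hy)).hasFDerivAt

/-- Local inverse of a holomorphic map with invertible derivative. -/
lemma hol_local_inverse [FiniteDimensional ℂ E] {f : E → F} {U : Set E} (hU : IsOpen U)
    (hf : DifferentiableOn ℂ f U) {a : E} (ha : a ∈ U) (e : E ≃L[ℂ] F)
    (he : fderiv ℂ f a = e) :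
    ∃ g : F → E, g (f a) = a ∧ HasStrictFDerivAt g (e.symm : F →L[ℂ] E) (f a) ∧
      (∀ᶠ x in 𝓝 a, g (f x) = x) ∧ (∀ᶠ y in 𝓝 (f a), f (g y) = y) ∧
      (∀ᶠ y in 𝓝 (f a), DifferentiableAt ℂ g y) := by
  have : CompleteSpace E := FiniteDimensional.complete ℂ E
  have hs := hol_strict hU hf ha
  rw [he] at hs
  refine ⟨hs.localInverse f e a, hs.localInverse_apply_image, hs.to_localInverse,
    hs.eventually_left_inverse, hs.eventually_right_inverse, ?_⟩
  -- the derivative remains invertible nearby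
  have hcont : ContinuousAt (fderiv ℂ f) a := by
    have : ProperSpace E := FiniteDimensional.proper ℂ E
    exact (hol_fderiv_continuousOn hU hf).continuousAt (hU.mem_nhds ha)
  have hinv : ∀ᶠ x in 𝓝 a, ∃ e' : E ≃L[ℂ] F, fderiv ℂ f x = e' := by
    have := hcont.eventually (he ▸ ContinuousLinearEquiv.nhds e)
    filter_upwards [this] with x hx
    obtain ⟨e', h'⟩ := hx
    exact ⟨e', h'.symm⟩
  have h1 := hs.localInverse_tendsto
  have h2 := h1.eventually (hinv.and (hU.mem_nhds ha))
  have hopen := (hs.toOpenPartialHomeomorph f).open_target.mem_nhds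
    hs.image_mem_toOpenPartialHomeomorph_target
  filter_upwards [h2, hopen] with y hy hyt
  obtain ⟨⟨e', he'⟩, hyU⟩ := hy
  have h3 := ((hf _ hyU).differentiableAt (hU.mem_nhds hyU)).hasFDerivAt
  rw [he'] at h3
  have := (hs.toOpenPartialHomeomorph f).hasFDerivAt_symm hyt h3
  exact this.differentiableAt
end P1

open Metric Set Filter Topology
section P2

lemma flatten {E : Type*} [NormedAddCommGroup E] [NormedSpace ℂ E] [FiniteDimensional ℂ E]
    {g : E → ℂ} {U : Set E} (hU : IsOpen U) (hg : DifferentiableOn ℂ g U) {a : E} (ha : a ∈ U)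
    (hga : g a = 0) {v : E} {L : E →L[ℂ] ℂ} (hL : fderiv ℂ g a = L) (hv : L v = 1) :
    ∃ Θ : E → E, Θ 0 = a ∧ HasStrictFDerivAt Θ (ContinuousLinearMap.id ℂ E) 0 ∧
      (∀ᶠ z in 𝓝 a, Θ (z - a + (g z - L (z - a)) • v) = z) ∧
      (∀ᶠ w in 𝓝 (0 : E), Θ w - a + (g (Θ w) - L (Θ w - a)) • v = w) ∧
      (∀ᶠ w in 𝓝 (0 : E), DifferentiableAt ℂ Θ w) ∧
      (∀ᶠ w in 𝓝 (0 : E), g (Θ w) = L w) := by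
  set Ψ : E → E := fun z => z - a + (g z - L (z - a)) • v with hΨ
  have hΨd : DifferentiableOn ℂ Ψ U := by
    refine (differentiableOn_id.sub_const a).add ?_
    refine DifferentiableOn.smul_const ?_ v
    exact hg.sub (L.differentiable.comp_differentiableOn (differentiableOn_id.sub_const a))
  have hΨa : Ψ a = 0 := by simp [hΨ, hga]
  have hfd : fderiv ℂ Ψ a = (ContinuousLinearEquiv.refl ℂ E : E ≃L[ℂ] E) := by
    have hgd : HasFDerivAt g L a := hL ▸ ((hg a ha).differentiableAt (hU.mem_nhds ha)).hasFDerivAt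
    have h1 : HasFDerivAt (fun z => z - a) (ContinuousLinearMap.id ℂ E) a :=
      (hasFDerivAt_id a).sub_const a
    have h2 : HasFDerivAt (fun z => L (z - a)) L a := by
      have := L.hasFDerivAt.comp a h1
      rwa [ContinuousLinearMap.comp_id] at this
    have h3 : HasFDerivAt Ψ _ a := h1.add ((hgd.sub h2).smul_const v)
    rw [h3.fderiv]
    ext w
    simp
  obtain ⟨Θ, h0, h1, h2, h3, h4⟩ := hol_local_inverse hU hΨd ha _ hfd
  rw [hΨa] at h0 h1 h3 h4
  refine ⟨Θ, h0, h1, h2, h3, h4, ?_⟩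
  filter_upwards [h3] with w hw
  have : L (Ψ (Θ w)) = L w := by rw [hw]
  rw [← this]
  simp [hΨ, hv]

lemma injOn_deriv_ne_zero {f : ℂ → ℂ} {U : Set ℂ} (hU : IsOpen U) (hf : DifferentiableOn ℂ f U)
    (hi : InjOn f U) {a : ℂ} (ha : a ∈ U) : deriv f a ≠ 0 := by
  intro h0
  have han : ∀ z ∈ U, AnalyticAt ℂ f z := fun z hz => hf.analyticAt (hU.mem_nhds hz)
  have hnc : ∀ z ∈ U, ¬ ∀ᶠ y in 𝓝 z, f y = f z := by
    intro z hz h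
    have h1 : ∀ᶠ y in 𝓝 z, y = z := by
      filter_upwards [h, hU.mem_nhds hz] with y hy hyU
      exact hi hyU hz hy
    have h2 : ∀ᶠ y in 𝓝[≠] z, y = z := h1.filter_mono nhdsWithin_le_nhds
    have h3 : ∀ᶠ y in 𝓝[≠] z, y ≠ z := self_mem_nhdsWithin
    obtain ⟨y, hy, hy'⟩ := (h2.and h3).exists
    exact hy' hy
  have hop : ∀ z ∈ U, 𝓝 (f z) ≤ map f (𝓝 z) := fun z hz =>
    ((han z hz).eventually_constant_or_nhds_le_map_nhds).resolve_left (hnc z hz)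
  set G := Function.invFunOn f U with hG
  have hGf : ∀ z ∈ U, G (f z) = z := fun z hz => hi.leftInvOn_invFunOn hz
  have hGc : ∀ z ∈ U, ContinuousAt G (f z) := by
    intro z hz
    rw [ContinuousAt, hGf z hz]
    refine Tendsto.mono_left ?_ (hop z hz)
    rw [tendsto_map'_iff]
    refine tendsto_id.congr' ?_
    filter_upwards [hU.mem_nhds hz] with y hy
    simp [hGf y hy]
  have hd0 : ∀ᶠ z in 𝓝[≠] a, deriv f z ≠ 0 := by
    rcases (han a ha).deriv.eventually_eq_zero_or_eventually_ne_zero with h | h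
    · exfalso
      apply hnc a ha
      obtain ⟨r, hr, hrs⟩ := Metric.mem_nhds_iff.1 (Filter.inter_mem h (hU.mem_nhds ha))
      filter_upwards [ball_mem_nhds a hr] with y hy
      exact (convex_ball a r).is_const_of_fderivWithin_eq_zero (𝕜 := ℂ) (f := f)
        (hf.mono fun z hz => (hrs hz).2)
        (fun z hz => by
          rw [fderivWithin_of_isOpen isOpen_ball hz]
          ext
          simpa using (hrs hz).1) hy (mem_ball_self hr)
    · exact h
  have hGd : ∀ᶠ w in 𝓝[≠] (f a), DifferentiableAt ℂ G w := by
    rw [eventually_nhdsWithin_iff] at hd0 ⊢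
    apply (hop a ha)
    rw [mem_map]
    filter_upwards [hd0, hU.mem_nhds ha, hU.eventually_mem ha] with z hz hzU _ hne
    have hza : z ≠ a := fun h => hne (by simp [h])
    have hder : HasDerivAt f (deriv f z) z :=
      ((hf z hzU).differentiableAt (hU.mem_nhds hzU)).hasDerivAt
    have hst := (han z hzU).hasStrictDerivAt
    have := hst.to_local_left_inverse (hz hza) (g := G) (by
      filter_upwards [hU.mem_nhds hzU] with y hy using hGf y hy)
    exact this.hasDerivAt.differentiableAt
  have hGa : DifferentiableAt ℂ G (f a) :=
    (Complex.analyticAt_of_differentiable_on_punctured_nhds_of_continuousAt hGd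
      (hGc a ha)).differentiableAt
  have hder : HasDerivAt f 0 a := by
    rw [← h0]; exact ((hf a ha).differentiableAt (hU.mem_nhds ha)).hasDerivAt
  have hcomp := hGa.hasDerivAt.comp a hder
  have hid : HasDerivAt (G ∘ f) 1 a := by
    refine (hasDerivAt_id a).congr_of_eventuallyEq ?_
    filter_upwards [hU.mem_nhds ha] with y hy
    simp [hGf y hy]
  have := hcomp.unique hid
  simp at this

/-- A holomorphic function whose restriction to a complex line does not vanish identically has
zeros on all nearby parallel lines. -/
lemma hurwitz_line {E : Type*} [NormedAddCommGroup E] [NormedSpace ℂ E]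
    {h : E → ℂ} {U : Set E} (hU : IsOpen U) (hh : DifferentiableOn ℂ h U) {a v : E} (ha : a ∈ U)
    (h0 : h a = 0) (hv : ¬ ∀ᶠ t in 𝓝 (0 : ℂ), h (a + t • v) = 0) {ε : ℝ} (hε : 0 < ε) :
    ∀ᶠ z in 𝓝 a, ∃ t : ℂ, ‖t‖ < ε ∧ h (z + t • v) = 0 := by
  have hlc : Continuous fun t : ℂ => a + t • v := by fun_prop
  have hpre : {t : ℂ | a + t • v ∈ U} ∈ 𝓝 (0 : ℂ) :=
    hlc.continuousAt.preimage_mem_nhds (by simpa using hU.mem_nhds ha)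
  have hVo : IsOpen {t : ℂ | a + t • v ∈ U} := hU.preimage hlc
  have hld : DifferentiableOn ℂ (fun t : ℂ => h (a + t • v)) {t : ℂ | a + t • v ∈ U} :=
    fun t ht => ((hh _ ht).differentiableAt (hU.mem_nhds ht)).comp t
      (by fun_prop : DifferentiableAt ℂ (fun t : ℂ => a + t • v) t) |>.differentiableWithinAt
  have hla : AnalyticAt ℂ (fun t : ℂ => h (a + t • v)) 0 := hld.analyticAt hpre
  have hne := hla.eventually_eq_zero_or_eventually_ne_zero.resolve_left hv
  rw [eventually_nhdsWithin_iff] at hne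
  obtain ⟨r, hr, hrs⟩ := Metric.mem_nhds_iff.1 (Filter.inter_mem hne hpre)
  set δ := min (r / 2) (ε / 2) with hδ
  have hδ0 : 0 < δ := by positivity
  have hδr : δ < r := lt_of_le_of_lt (min_le_left _ _) (by linarith)
  have hδε : δ < ε := lt_of_le_of_lt (min_le_right _ _) (by linarith)
  -- the compact disc
  have hcb : ∀ t ∈ closedBall (0 : ℂ) δ, t ∈ ball (0 : ℂ) r := fun t ht =>
    closedBall_subset_ball hδr ht
  obtain ⟨c, hc, hcs⟩ : ∃ c > 0, ∀ t ∈ sphere (0 : ℂ) δ, c ≤ ‖h (a + t • v)‖ := by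
    have hcomp : IsCompact (sphere (0 : ℂ) δ) := isCompact_sphere _ _
    have hcont : ContinuousOn (fun t : ℂ => ‖h (a + t • v)‖) (sphere (0 : ℂ) δ) :=
      (hld.continuousOn.mono fun t ht => (hrs (hcb t (sphere_subset_closedBall ht))).2).norm
    obtain ⟨t0, ht0, hmin⟩ := hcomp.exists_isMinOn (NormedSpace.sphere_nonempty.2 hδ0.le) hcont
    refine ⟨_, ?_, fun t ht => hmin ht⟩
    have hm := (hrs (hcb t0 (sphere_subset_closedBall ht0))).1
    refine norm_pos_iff.2 (hm ?_)
    intro h00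
    rw [mem_singleton_iff] at h00
    rw [h00] at ht0
    simp at ht0
    linarith
  -- uniformity over the disc
  have hunif : ∀ᶠ z in 𝓝 a, ∀ t ∈ closedBall (0 : ℂ) δ,
      z + t • v ∈ U ∧ ‖h (z + t • v) - h (a + t • v)‖ < c / 2 := by
    refine (isCompact_closedBall (0 : ℂ) δ).eventually_forall_of_forall_eventually ?_
    intro t ht
    have hmem : a + t • v ∈ U := (hrs (hcb t ht)).2
    have hca : ContinuousAt h (a + t • v) := hh.continuousOn.continuousAt (hU.mem_nhds hmem)
    have hc1 : ContinuousAt (fun p : E × ℂ => p.1 + p.2 • v) (a, t) := by fun_prop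
    have hc2 : ContinuousAt (fun p : E × ℂ => a + p.2 • v) (a, t) := by fun_prop
    have e1 : ∀ᶠ p : E × ℂ in 𝓝 (a, t), p.1 + p.2 • v ∈ U := hc1 (hU.mem_nhds hmem)
    have hc3 : ContinuousAt (fun p : E × ℂ => h (p.1 + p.2 • v)) (a, t) :=
      ContinuousAt.comp (f := fun p : E × ℂ => p.1 + p.2 • v) (g := h) hca hc1
    have hc4 : ContinuousAt (fun p : E × ℂ => h (a + p.2 • v)) (a, t) :=
      ContinuousAt.comp (f := fun p : E × ℂ => a + p.2 • v) (g := h) hca hc2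
    have e2 := (hc3.sub hc4).norm.eventually_lt_const (u := c / 2) (by simpa using hc)
    filter_upwards [e1, e2] with p hp1 hp2 using ⟨hp1, hp2⟩
  have hsmall : ∀ᶠ z in 𝓝 a, ‖h z‖ < c / 2 := by
    have hca : ContinuousAt h a := hh.continuousOn.continuousAt (hU.mem_nhds ha)
    exact hca.norm.eventually_lt_const (by simpa [h0] using hc)
  filter_upwards [hunif, hsmall] with z hz hzs
  by_contra hcon
  push Not at hcon
  have hnz : ∀ t ∈ closedBall (0 : ℂ) δ, h (z + t • v) ≠ 0 := fun t ht =>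
    hcon t (by rw [mem_closedBall_zero_iff] at ht; linarith)
  have hdz : ∀ t ∈ closedBall (0 : ℂ) δ, DifferentiableAt ℂ (fun t : ℂ => (h (z + t • v))⁻¹) t :=
    fun t ht => (((hh _ (hz t ht).1).differentiableAt (hU.mem_nhds (hz t ht).1)).comp t
      (by fun_prop : DifferentiableAt ℂ (fun t : ℂ => z + t • v) t)).inv (hnz t ht)
  have hdc : DiffContOnCl ℂ (fun t : ℂ => (h (z + t • v))⁻¹) (ball 0 δ) := by
    refine DifferentiableOn.diffContOnCl fun t ht => ?_
    exact (hdz t (closure_ball_subset_closedBall ht)).differentiableWithinAt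
  have hmax := Complex.norm_le_of_forall_mem_frontier_norm_le (C := (c / 2)⁻¹) isBounded_ball hdc
    (fun t ht => by
      rw [frontier_ball _ hδ0.ne'] at ht
      have h1 := hcs t ht
      have h2 := (hz t (sphere_subset_closedBall ht)).2
      rw [norm_inv]
      refine inv_anti₀ (by positivity) ?_
      have := norm_sub_norm_le (h (a + t • v)) (h (z + t • v))
      rw [norm_sub_rev] at this
      linarith) (subset_closure (mem_ball_self hδ0 : (0 : ℂ) ∈ ball 0 δ))
  simp only [zero_smul, add_zero, norm_inv] at hmax
  have hz0 : 0 < ‖h z‖ := by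
    have := hnz 0 (mem_closedBall_self hδ0.le)
    simpa using this
  have := (inv_le_inv₀ hz0 (by positivity)).1 hmax
  linarith
end P2

open Metric Set Filter Topology
section P3

lemma osgood_step2 {E E' : Type*} [NormedAddCommGroup E] [NormedSpace ℂ E]
    [FiniteDimensional ℂ E] [NormedAddCommGroup E'] [NormedSpace ℂ E']
    (hdim : 2 ≤ Module.finrank ℂ E) {F : E → E'} {h : E → ℂ} {a₀ : E} {r : ℝ} (hr : 0 < r)
    (hF : DifferentiableOn ℂ F (ball a₀ r)) (hi : InjOn F (ball a₀ r))
    (hh : DifferentiableOn ℂ h (ball a₀ r)) (h0 : h a₀ = 0)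
    (hZ : ∀ z ∈ ball a₀ r, h z = 0 → fderiv ℂ F z = 0) : False := by
  have : ProperSpace E := FiniteDimensional.proper ℂ E
  have hnt : Nontrivial E := Module.nontrivial_of_finrank_pos (R := ℂ) (by omega)
  set D : E → (E → ℂ) → (E → ℂ) := fun v f z => fderiv ℂ f z v with hD
  have hDd : ∀ v m, DifferentiableOn ℂ ((D v)^[m] h) (ball a₀ r) := by
    intro v m
    induction m with
    | zero => exact hh
    | succ m ih =>
      rw [Function.iterate_succ_apply']
      exact hol_dirDeriv_differentiableOn isOpen_ball ih v
  have hex : ∃ m, ∃ v, ∃ z ∈ ball a₀ r, h z = 0 ∧ (D v)^[m] h z ≠ 0 := by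
    by_contra hcon
    push Not at hcon
    have hall : ∀ b ∈ ball a₀ r, h b = 0 := by
      intro b hb
      set v := b - a₀ with hv
      set V : Set ℂ := {t : ℂ | a₀ + t • v ∈ ball a₀ r} with hV
      have hlc : Continuous fun t : ℂ => a₀ + t • v := by fun_prop
      have hVo : IsOpen V := isOpen_ball.preimage hlc
      have h0V : (0 : ℂ) ∈ V := by simp [hV, hr]
      have h1V : (1 : ℂ) ∈ V := by simpa [hV, hv, dist_eq_norm] using hb
      have hVc : IsPreconnected V := by
        have hVeq : V = ball 0 (r / ‖v‖) ∨ v = 0 := by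
          by_cases hv0 : v = 0
          · exact Or.inr hv0
          · left
            ext t
            simp only [hV, Set.mem_ofPred_eq, mem_ball, dist_self_add_left, norm_smul, dist_zero_right]
            rw [lt_div_iff₀ (norm_pos_iff.2 hv0)]
        rcases hVeq with h1 | h1
        · rw [h1]; exact (convex_ball _ _).isPreconnected
        · have : V = univ := by ext t; simp [hV, h1, hr]
          rw [this]; exact isPreconnected_univ
      have hder : ∀ m, ∀ t ∈ V, HasDerivAt (fun t : ℂ => (D v)^[m] h (a₀ + t • v))
          ((D v)^[m + 1] h (a₀ + t • v)) t := by
        intro m t ht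
        have h1 := ((hDd v m _ ht).differentiableAt (isOpen_ball.mem_nhds ht)).hasFDerivAt
        have h2 : HasDerivAt (fun t : ℂ => a₀ + t • v) v t := by
          simpa using ((hasDerivAt_id t).smul_const v).const_add a₀
        have := h1.comp_hasDerivAt t h2
        rw [Function.iterate_succ_apply']
        exact this
      have hit : ∀ m, ∀ t ∈ V, iteratedDeriv m (fun t : ℂ => h (a₀ + t • v)) t
          = (D v)^[m] h (a₀ + t • v) := by
        intro m
        induction m with
        | zero => intro t _; simp
        | succ m ih =>
          intro t ht
          rw [iteratedDeriv_succ]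
          have : iteratedDeriv m (fun t : ℂ => h (a₀ + t • v)) =ᶠ[𝓝 t]
              fun t => (D v)^[m] h (a₀ + t • v) := by
            filter_upwards [hVo.mem_nhds ht] with s hs using ih s hs
          rw [this.deriv_eq]
          exact (hder m t ht).deriv
      have hdV : DifferentiableOn ℂ (fun t : ℂ => h (a₀ + t • v)) V := fun t ht =>
        (hder 0 t ht).differentiableAt.differentiableWithinAt
      have han : AnalyticOnNhd ℂ (fun t : ℂ => h (a₀ + t • v)) V := hdV.analyticOnNhd hVo
      have hord : analyticOrderAt (fun t : ℂ => h (a₀ + t • v)) 0 = ⊤ := by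
        rw [ENat.eq_top_iff_forall_ge]
        intro m
        rw [natCast_le_analyticOrderAt_iff_iteratedDeriv_eq_zero (han 0 h0V)]
        intro i _
        rw [hit i 0 h0V]
        simpa using hcon i v a₀ (mem_ball_self hr) h0
      have hz := analyticOrderAt_eq_top.1 hord
      have := han.eqOn_zero_of_preconnected_of_eventuallyEq_zero hVc h0V hz h1V
      simpa [hv] using this
    obtain ⟨w, hw⟩ := exists_ne (0 : E)
    have hwn : 0 < ‖w‖ := norm_pos_iff.2 hw
    have hb : a₀ + ((r / (2 * ‖w‖) : ℝ) : ℂ) • w ∈ ball a₀ r := by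
      rw [mem_ball, dist_self_add_left, norm_smul, Complex.norm_real, Real.norm_of_nonneg (by positivity)]
      rw [div_mul_eq_mul_div, div_lt_iff₀ (by positivity)]
      nlinarith
    have hcst := (convex_ball a₀ r).is_const_of_fderivWithin_eq_zero (𝕜 := ℂ) hF
      (fun z hz => by
        rw [fderivWithin_of_isOpen isOpen_ball hz]; exact hZ z hz (hall z hz)) hb (mem_ball_self hr)
    have := hi hb (mem_ball_self hr) hcst
    simp [hw, hr.ne'] at this
  classical
  obtain ⟨v₀, a, haB, ha0, hne⟩ := Nat.find_spec hex
  have hmin := fun m (hm : m < Nat.find hex) => Nat.find_min hex hm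
  rcases hm : Nat.find hex with _ | m
  · rw [hm] at hne; exact hne ha0
  rw [hm] at hne hmin
  rw [Function.iterate_succ_apply'] at hne
  set g := (D v₀)^[m] h with hg
  have hgd : DifferentiableOn ℂ g (ball a₀ r) := hDd v₀ m
  have hgZ : ∀ z ∈ ball a₀ r, h z = 0 → g z = 0 := by
    intro z hz hhz
    by_contra hgz
    exact hmin m (Nat.lt_succ_self m) ⟨v₀, z, hz, hhz, hgz⟩
  set L : E →L[ℂ] ℂ := fderiv ℂ g a with hL
  have hc : L v₀ ≠ 0 := hne
  set v := (L v₀)⁻¹ • v₀ with hv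
  have hLv : L v = 1 := by simp [hv, hc]
  have hga : g a = 0 := hgZ a haB ha0
  have hBn := isOpen_ball.mem_nhds haB
  have hgL : HasFDerivAt g L a := ((hgd a haB).differentiableAt hBn).hasFDerivAt
  have hnotev : ¬ ∀ᶠ t in 𝓝 (0 : ℂ), h (a + t • v) = 0 := by
    intro hev
    have hlc : ContinuousAt (fun t : ℂ => a + t • v) 0 := by fun_prop
    have hmem : ∀ᶠ t in 𝓝 (0 : ℂ), a + t • v ∈ ball a₀ r := hlc (by simpa using hBn)
    have hz : (fun t : ℂ => g (a + t • v)) =ᶠ[𝓝 0] fun _ => 0 := by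
      filter_upwards [hev, hmem] with t h1 h2 using hgZ _ h2 h1
    have h2 : HasDerivAt (fun t : ℂ => a + t • v) v 0 := by
      simpa using ((hasDerivAt_id (0 : ℂ)).smul_const v).const_add a
    have hgL' : HasFDerivAt g L (a + (0 : ℂ) • v) := by simpa using hgL
    have h3 : HasDerivAt (fun t : ℂ => g (a + t • v)) (L v) 0 := hgL'.comp_hasDerivAt 0 h2
    have h4 := hz.deriv_eq
    rw [h3.deriv, hLv] at h4
    simp at h4
  obtain ⟨Θ, hΘ0, hΘs, hΘΨ, hΨΘ, hΘd, hgΘ⟩ := flatten isOpen_ball hgd haB hga hL.symm hLv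
  obtain ⟨η, hη, hηs⟩ := Metric.mem_nhds_iff.1 (Filter.inter_mem hΘΨ hBn)
  have hΘc : Tendsto Θ (𝓝 0) (𝓝 a) := by
    have := hΘs.hasFDerivAt.continuousAt
    rwa [ContinuousAt, hΘ0] at this
  have hhur := hurwitz_line isOpen_ball hh haB ha0 hnotev (ε := η / (2 * (‖v‖ + 1)))
    (by positivity)
  have hev := hΘc.eventually (hhur.and (ball_mem_nhds a (half_pos hη)))
  obtain ⟨σ, hσ, hσs⟩ := Metric.mem_nhds_iff.1
    (Filter.inter_mem (Filter.inter_mem hev hΨΘ) (Filter.inter_mem hΘd hgΘ))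
  have hkey : ∀ w ∈ ball (0 : E) σ, L w = 0 → fderiv ℂ F (Θ w) = 0 ∧ Θ w ∈ ball a₀ r := by
    intro w hw hLw
    obtain ⟨⟨⟨⟨t, ht, hht⟩, hΘb⟩, hΨw⟩, -, hgw⟩ := hσs hw
    have hgw0 : g (Θ w) = 0 := by rw [← hLw]; exact hgw
    have htv : ‖t • v‖ < η / 2 := by
      rw [norm_smul]
      calc ‖t‖ * ‖v‖ ≤ ‖t‖ * (‖v‖ + 1) := by gcongr; linarith
        _ < η / (2 * (‖v‖ + 1)) * (‖v‖ + 1) := by gcongr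
        _ = η / 2 := by field_simp
    have hΘη : Θ w ∈ ball a η := ball_subset_ball (by linarith) hΘb
    have hzη : Θ w + t • v ∈ ball a η := by
      have hΘb2 : ‖Θ w - a‖ < η / 2 := by rw [← dist_eq_norm]; exact hΘb
      rw [mem_ball, dist_eq_norm]
      have : Θ w + t • v - a = (Θ w - a) + t • v := by abel
      rw [this]; linarith [norm_add_le (Θ w - a) (t • v)]
    have hg2 : g (Θ w + t • v) = 0 := hgZ _ (hηs hzη).2 hht
    have e1 : Θ (Θ w - a + (g (Θ w) - L (Θ w - a)) • v) = Θ w := (hηs hΘη).1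
    have e2 : Θ (Θ w + t • v - a + (g (Θ w + t • v) - L (Θ w + t • v - a)) • v) = Θ w + t • v :=
      (hηs hzη).1
    have e3 : Θ w + t • v - a + (g (Θ w + t • v) - L (Θ w + t • v - a)) • v
        = Θ w - a + (g (Θ w) - L (Θ w - a)) • v := by
      rw [hg2, hgw0]
      simp only [map_sub, map_add, map_smul, hLv]
      module
    rw [e3, e1] at e2
    have hz : h (Θ w) = 0 := by rw [e2]; exact hht
    exact ⟨hZ _ (hηs hΘη).2 hz, (hηs hΘη).2⟩
  obtain ⟨w₁, hw₁, hw₁0⟩ : ∃ w, L w = 0 ∧ w ≠ 0 := by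
    have := LinearMap.ker_ne_bot_of_finrank_lt (f := (L : E →ₗ[ℂ] ℂ)) (by simp; omega)
    obtain ⟨w, hw, hw0⟩ := Submodule.exists_mem_ne_zero_of_ne_bot this
    exact ⟨w, by simpa using hw, hw0⟩
  have hwn : 0 < ‖w₁‖ := norm_pos_iff.2 hw₁0
  set w := ((σ / (2 * ‖w₁‖) : ℝ) : ℂ) • w₁ with hw
  have hw0 : w ≠ 0 := by simp [hw, hw₁0, hσ.ne']
  have hLw : L w = 0 := by simp [hw, hw₁]
  have hwσ : ‖w‖ < σ := by
    rw [hw, norm_smul, Complex.norm_real, Real.norm_of_nonneg (by positivity),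
      div_mul_eq_mul_div, div_lt_iff₀ (by positivity)]
    nlinarith
  have hwpos : 0 < ‖w‖ := norm_pos_iff.2 hw0
  have hin : ∀ s ∈ ball (0 : ℂ) (σ / ‖w‖), s • w ∈ ball (0 : E) σ := by
    intro s hs
    rw [mem_ball_zero_iff] at hs ⊢
    rwa [norm_smul, ← lt_div_iff₀ hwpos]
  have hpath : ∀ s ∈ ball (0 : ℂ) (σ / ‖w‖), HasDerivAt (fun s : ℂ => F (Θ (s • w))) 0 s := by
    intro s hs
    obtain ⟨hF0, hmem⟩ := hkey (s • w) (hin s hs) (by simp [hLw])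
    have h1 := ((hF _ hmem).differentiableAt (isOpen_ball.mem_nhds hmem)).hasFDerivAt
    have h2 : DifferentiableAt ℂ Θ (s • w) := (hσs (hin s hs)).2.1
    have h3 : HasDerivAt (fun s : ℂ => s • w) w s := by
      simpa using (hasDerivAt_id s).smul_const w
    have h4 := h1.comp_hasDerivAt s (h2.hasFDerivAt.comp_hasDerivAt s h3)
    rw [hF0] at h4
    exact h4
  have h1m : (1 : ℂ) ∈ ball (0 : ℂ) (σ / ‖w‖) := by
    rw [mem_ball_zero_iff, norm_one, lt_div_iff₀ hwpos]; linarith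
  have h0m : (0 : ℂ) ∈ ball (0 : ℂ) (σ / ‖w‖) := mem_ball_self (by positivity)
  have hcst := (convex_ball (0 : ℂ) (σ / ‖w‖)).is_const_of_fderivWithin_eq_zero (𝕜 := ℂ)
    (fun s hs => (hpath s hs).differentiableAt.differentiableWithinAt)
    (fun s hs => by
      rw [fderivWithin_of_isOpen isOpen_ball hs]
      ext; simpa using (hpath s hs).deriv) h1m h0m
  simp only [one_smul, zero_smul, hΘ0] at hcst
  have hwm : w ∈ ball (0 : E) σ := by simpa using hwσ
  have hΘw := hi (hkey w hwm hLw).2 haB hcst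
  have hΨw : Θ w - a + (g (Θ w) - L (Θ w - a)) • v = w := (hσs hwm).1.2
  rw [hΘw, hga] at hΨw
  simp at hΨw
  exact hw0 hΨw.symm
end P3

open Metric Set Filter Topology
section P4
universe u

def OsgoodAt (n : ℕ) : Prop :=
  ∀ (E E' : Type u) [NormedAddCommGroup E] [NormedSpace ℂ E] [FiniteDimensional ℂ E]
    [NormedAddCommGroup E'] [NormedSpace ℂ E'] [FiniteDimensional ℂ E'],
    Module.finrank ℂ E = n → Module.finrank ℂ E' = n →
    ∀ (F : E → E') (U : Set E) (a : E), IsOpen U → DifferentiableOn ℂ F U → InjOn F U → a ∈ U →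
      ∀ v, fderiv ℂ F a v = 0 → v = 0

lemma finrank_ker_of_one {E : Type*} [NormedAddCommGroup E] [NormedSpace ℂ E]
    [FiniteDimensional ℂ E] (L : E →L[ℂ] ℂ) (v : E) (h : L v = 1) :
    Module.finrank ℂ (LinearMap.ker (L : E →ₗ[ℂ] ℂ)) + 1 = Module.finrank ℂ E := by
  have h1 := LinearMap.finrank_range_add_finrank_ker (L : E →ₗ[ℂ] ℂ)
  have h2 : LinearMap.range (L : E →ₗ[ℂ] ℂ) = ⊤ := by
    rw [LinearMap.range_eq_top]
    intro c
    exact ⟨c • v, by simp [h]⟩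
  rw [h2, finrank_top, Module.finrank_self] at h1
  omega

lemma osgood_step1 {n : ℕ} (IH : OsgoodAt.{u} n)
    {E E' : Type u} [NormedAddCommGroup E] [NormedSpace ℂ E] [FiniteDimensional ℂ E]
    [NormedAddCommGroup E'] [NormedSpace ℂ E'] [FiniteDimensional ℂ E']
    (hE : Module.finrank ℂ E = n + 1) (hE' : Module.finrank ℂ E' = n + 1)
    {F : E → E'} {U : Set E} {a : E} (hU : IsOpen U) (hF : DifferentiableOn ℂ F U)
    (hi : InjOn F U) (ha : a ∈ U) (hne : fderiv ℂ F a ≠ 0) :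
    ∀ v, fderiv ℂ F a v = 0 → v = 0 := by
  obtain ⟨v1, hv1⟩ : ∃ v, fderiv ℂ F a v ≠ 0 := by
    by_contra hcon
    push Not at hcon
    exact hne (by ext v; simpa using hcon v)
  obtain ⟨μ, hμ⟩ := SeparatingDual.exists_eq_one (R := ℂ) hv1
  set y1 := fderiv ℂ F a v1 with hy1
  set g : E → ℂ := fun z => μ (F z) - μ (F a) with hg
  set L : E →L[ℂ] ℂ := μ.comp (fderiv ℂ F a) with hL
  have hFa : HasFDerivAt F (fderiv ℂ F a) a :=
    ((hF a ha).differentiableAt (hU.mem_nhds ha)).hasFDerivAt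
  have hgd : DifferentiableOn ℂ g U := (μ.differentiable.comp_differentiableOn hF).sub_const _
  have hgL : fderiv ℂ g a = L := by
    have : HasFDerivAt g L a := (μ.hasFDerivAt.comp a hFa).sub_const _
    exact this.fderiv
  obtain ⟨Θ, hΘ0, hΘs, hΘΨ, hΨΘ, hΘd, hgΘ⟩ := flatten hU hgd ha (by simp [hg]) hgL
    (show L v1 = 1 from hμ)
  have hΘc : Tendsto Θ (𝓝 0) (𝓝 a) := by
    have := hΘs.hasFDerivAt.continuousAt
    rwa [ContinuousAt, hΘ0] at this
  have hev := hΘc.eventually (hU.mem_nhds ha)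
  obtain ⟨σ, hσ, hσs⟩ := Metric.mem_nhds_iff.1
    (Filter.inter_mem (Filter.inter_mem hev hΨΘ) (Filter.inter_mem hΘd hgΘ))
  set K := LinearMap.ker (L : E →ₗ[ℂ] ℂ) with hK
  set K' := LinearMap.ker (μ : E' →ₗ[ℂ] ℂ) with hK'
  set P : E' →L[ℂ] K' := (ContinuousLinearMap.id ℂ E' - μ.smulRight y1).codRestrict K'
    (fun y => by simp [hK', hμ]) with hP
  have hPc : ∀ y, (P y : E') = y - μ y • y1 := by intro y; simp [hP]
  have hkL : ∀ w : K, L w = 0 := fun w => w.2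
  have hb : ∀ w : K, w ∈ ball (0 : K) σ → (w : E) ∈ ball (0 : E) σ := by
    intro w hw
    simpa using hw
  have key := IH K K' (Nat.add_right_cancel ((finrank_ker_of_one L v1 hμ).trans hE))
    (Nat.add_right_cancel ((finrank_ker_of_one μ y1 hμ).trans hE'))
    (fun w => P (F (Θ w))) (ball 0 σ) 0 isOpen_ball ?_ ?_ (mem_ball_self hσ)
  · have hd : HasFDerivAt (fun w : K => P (F (Θ w)))
        (P.comp ((fderiv ℂ F a).comp ((ContinuousLinearMap.id ℂ E).comp K.subtypeL))) 0 := by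
      have h1 : HasFDerivAt Θ (ContinuousLinearMap.id ℂ E) ((K.subtypeL) 0) := by
        simpa using hΘs.hasFDerivAt
      have h2 := h1.comp (0 : K) K.subtypeL.hasFDerivAt
      have h3 : HasFDerivAt F (fderiv ℂ F a) ((Θ ∘ K.subtypeL) 0) := by simpa [hΘ0] using hFa
      exact P.hasFDerivAt.comp (0 : K) (h3.comp (0 : K) h2)
    rw [hd.fderiv] at key
    intro v hv
    have hvK : v ∈ K := by simp [hK, hL, hv]
    have := key ⟨v, hvK⟩ (by simp [hv])
    simpa using this
  · intro w hw
    obtain ⟨⟨h1, -⟩, h2, -⟩ := hσs (hb w hw)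
    have h3 : DifferentiableAt ℂ F (Θ w) := (hF _ h1).differentiableAt (hU.mem_nhds h1)
    have h4 : DifferentiableAt ℂ Θ (K.subtypeL w) := h2
    have h5 : DifferentiableAt ℂ F ((Θ ∘ K.subtypeL) w) := h3
    exact (P.differentiableAt.comp w (h5.comp w (h4.comp w
      K.subtypeL.differentiableAt))).differentiableWithinAt
  · intro w hw w' hw' heq
    obtain ⟨⟨h1, h2⟩, -, h3⟩ := hσs (hb w hw)
    obtain ⟨⟨h1', h2'⟩, -, h3'⟩ := hσs (hb w' hw')
    have h3 : μ (F (Θ w)) - μ (F a) = L w := h3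
    have h3' : μ (F (Θ w')) - μ (F a) = L w' := h3'
    rw [hkL] at h3 h3'
    have hm : μ (F (Θ w)) = μ (F (Θ w')) := by linear_combination h3 - h3'
    have he := congrArg (Subtype.val) heq
    simp only [hPc, hm] at he
    have hFe : F (Θ w) = F (Θ w') := by simpa using he
    have hΘe := hi h1 h1' hFe
    have h2 : Θ w - a + (g (Θ w) - L (Θ w - a)) • v1 = w := h2
    have h2' : Θ w' - a + (g (Θ w') - L (Θ w' - a)) • v1 = w' := h2'
    rw [hΘe] at h2
    exact Subtype.ext (h2.symm.trans h2')

lemma diffOn_prod {ι E : Type*} [Fintype ι] [NormedAddCommGroup E] [NormedSpace ℂ E]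
    {f : ι → E → ℂ} {U : Set E} (h : ∀ i, DifferentiableOn ℂ (f i) U) :
    DifferentiableOn ℂ (fun z => ∏ i, f i z) U := by
  classical
  intro z hz
  exact (HasFDerivWithinAt.finsetProd (u := Finset.univ) (g := f) fun i _ =>
    (h i z hz).hasFDerivWithinAt).differentiableWithinAt

theorem osgood : ∀ n, OsgoodAt.{u} n := by
  intro n
  induction n with
  | zero =>
    intro E E' _ _ _ _ _ _ hE hE' F U a hU hF hi ha v hv
    have := Module.finrank_zero_iff.1 hE
    exact Subsingleton.elim _ _
  | succ n IH =>
    intro E E' _ _ _ _ _ _ hE hE' F U a hU hF hi ha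
    by_cases hne : fderiv ℂ F a = 0
    swap
    · exact osgood_step1 IH hE hE' hU hF hi ha hne
    exfalso
    have hFa : HasFDerivAt F (fderiv ℂ F a) a :=
      ((hF a ha).differentiableAt (hU.mem_nhds ha)).hasFDerivAt
    rcases Nat.eq_zero_or_pos n with rfl | hn
    · let e : ℂ ≃L[ℂ] E := ContinuousLinearEquiv.ofFinrankEq (by simp [hE])
      let e' : E' ≃L[ℂ] ℂ := ContinuousLinearEquiv.ofFinrankEq (by simp [hE'])
      have hea : a = e (e.symm a) := by simp
      refine injOn_deriv_ne_zero (f := fun t => e' (F (e t))) (U := e ⁻¹' U) (a := e.symm a)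
        (hU.preimage e.continuous) ?_ ?_ (by simpa using ha) ?_
      · exact e'.differentiable.comp_differentiableOn
          (hF.comp e.differentiable.differentiableOn (fun t ht => ht))
      · intro t ht t' ht' h
        exact e.injective (hi ht ht' (e'.injective h))
      · rw [hea] at hFa
        have h1 : HasFDerivAt (fun t => e' (F (e t))) _ (e.symm a) :=
          e'.hasFDerivAt.comp (e.symm a) (hFa.comp (e.symm a) e.hasFDerivAt)
        have h2 := h1.hasDerivAt.deriv
        rw [h2]
        simp [hne]
    · obtain ⟨r, hr, hrU⟩ := Metric.mem_nhds_iff.1 (hU.mem_nhds ha)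
      let e' : E' ≃L[ℂ] E := ContinuousLinearEquiv.ofFinrankEq (by simp [hE, hE'])
      let b := Module.finBasis ℂ E
      have hFr := hF.mono hrU
      have hdet : ∀ z, LinearMap.det ((e' : E' →L[ℂ] E).comp (fderiv ℂ F z) : E →ₗ[ℂ] E)
          = Matrix.det (Matrix.of fun i j => b.coord i (e' (fderiv ℂ F z (b j)))) := by
        intro z
        rw [← LinearMap.det_toMatrix b]
        congr 1
        ext i j
        simp [LinearMap.toMatrix_apply]
      refine osgood_step2 (by omega) hr hFr (hi.mono hrU)
        (h := fun z => LinearMap.det ((e' : E' →L[ℂ] E).comp (fderiv ℂ F z) : E →ₗ[ℂ] E)) ?_ ?_ ?_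
      · simp_rw [hdet, Matrix.det_apply]
        refine DifferentiableOn.fun_sum fun σ _ => ?_
        refine DifferentiableOn.const_smul ?_ _
        refine diffOn_prod fun i => ?_
        have h1 := hol_dirDeriv_differentiableOn (isOpen_ball) hFr (b i)
        have h2 : Differentiable ℂ fun y => b.coord (σ i) (e' y) :=
          ((LinearMap.toContinuousLinearMap (b.coord (σ i))).comp
            (e' : E' →L[ℂ] E)).differentiable
        exact h2.comp_differentiableOn h1
      · have hz : ((e' : E' →L[ℂ] E).comp (fderiv ℂ F a) : E →ₗ[ℂ] E) = 0 := by
          rw [hne]; ext; simp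
        simp only [hz]
        rw [LinearMap.det_zero, hE]
        simp
      · intro z hz h0
        by_contra hz0
        have hinj := osgood_step1 IH hE hE' hU hF hi (hrU hz) hz0
        have h2 := LinearMap.bot_lt_ker_of_det_eq_zero h0
        obtain ⟨x, hx, hx0⟩ := Submodule.exists_mem_ne_zero_of_ne_bot h2.ne'
        exact hx0 (hinj x (by simpa using hx))
end P4

open Metric Set Filter Topology
set_option autoImplicit false
section P5

variable {E : Type*} [NormedAddCommGroup E] [NormedSpace ℂ E] [FiniteDimensional ℂ E]

lemma inj_fderiv_equiv {F : E → E}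
    (hF : Differentiable ℂ F) (hi : Function.Injective F) (c : E) :
    ∃ e : E ≃L[ℂ] E,
      fderiv ℂ F c = (e : E →L[ℂ] E) := by
  have h1 := osgood _ E E rfl rfl F univ c isOpen_univ hF.differentiableOn
    hi.injOn (mem_univ c)
  let A : E →ₗ[ℂ] E := (fderiv ℂ F c).toLinearMap
  have h2 : Function.Injective A := (injective_iff_map_eq_zero A).2 h1
  refine ⟨(LinearEquiv.ofInjectiveEndo A h2).toContinuousLinearEquiv, ?_⟩
  ext v : 1
  rfl

lemma fb_normal {Ω : Set (E)} {F₀ : E → E}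
    (hF₀ : Differentiable ℂ F₀) (hi₀ : Function.Injective F₀) (hr₀ : range F₀ = Ω)
    {p : E} (hp : p ∈ Ω) :
    ∃ F G : E → E,
      Differentiable ℂ F ∧ (∀ z, F z ∈ Ω) ∧ (∀ z, G (F z) = z) ∧ (∀ u ∈ Ω, F (G u) = u) ∧
      DifferentiableOn ℂ G Ω ∧ F 0 = p ∧
      HasFDerivAt F (ContinuousLinearMap.id ℂ (E)) 0 := by
  have hp' := hp
  rw [← hr₀] at hp'
  obtain ⟨c, hc⟩ := hp'
  obtain ⟨A, hA⟩ := inj_fderiv_equiv hF₀ hi₀ c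
  set F := fun z => F₀ (c + A.symm z) with hFdef
  have hF : Differentiable ℂ F :=
    hF₀.comp (A.symm.differentiable.const_add c)
  have hi : Function.Injective F := by
    intro z z' h
    have := hi₀ h
    simpa using this
  have hr : range F = Ω := by
    rw [← hr₀]
    ext u
    constructor
    · rintro ⟨z, rfl⟩; exact ⟨_, rfl⟩
    · rintro ⟨z, rfl⟩; exact ⟨A (z - c), by simp [hFdef]⟩
  have hGF : ∀ z, Function.invFun F (F z) = z := Function.leftInverse_invFun hi
  refine ⟨F, Function.invFun F, hF, fun z => hr ▸ ⟨z, rfl⟩, hGF, ?_, ?_, ?_, ?_⟩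
  · intro u hu
    rw [← hr] at hu
    obtain ⟨z, rfl⟩ := hu
    rw [hGF]
  · intro u hu
    rw [← hr] at hu
    obtain ⟨z, rfl⟩ := hu
    obtain ⟨e, he⟩ := inj_fderiv_equiv hF hi z
    obtain ⟨g, -, hg, -, hfg, -⟩ := hol_local_inverse isOpen_univ hF.differentiableOn
      (mem_univ z) e he
    have : Function.invFun F =ᶠ[𝓝 (F z)] g := by
      filter_upwards [hfg] with y hy
      conv_lhs => rw [← hy]
      exact hGF _
    exact (this.differentiableAt_iff.2 hg.hasFDerivAt.differentiableAt).differentiableWithinAt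
  · simp [hFdef, hc]
  · have h1 : HasFDerivAt F₀ (A : E →L[ℂ] _) (c + A.symm 0) := by
      have := (hF₀ c).hasFDerivAt
      rw [hA] at this
      simpa using this
    have h2 := h1.comp (0 : E) (A.symm.hasFDerivAt.const_add c)
    have h3 : ((A : E →L[ℂ] E).comp (A.symm : E →L[ℂ] E)) = ContinuousLinearMap.id ℂ E := by
      ext v : 1
      simp
    rw [h3] at h2
    exact h2

end P5

open Metric Set Filter Topology
set_option autoImplicit false
section P6
variable {E : Type*} [NormedAddCommGroup E] [NormedSpace ℂ E]

def IsAut (T : E → E) : Prop :=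
  Differentiable ℂ T ∧ ∃ S : E → E, Differentiable ℂ S ∧ Function.LeftInverse S T ∧
    Function.RightInverse S T

lemma IsAut.comp {T S : E → E} (hT : IsAut T) (hS : IsAut S) : IsAut (T ∘ S) := by
  obtain ⟨h1, T', h2, h3, h4⟩ := hT
  obtain ⟨g1, S', g2, g3, g4⟩ := hS
  exact ⟨h1.comp g1, S' ∘ T', g2.comp h2, h3.comp g3, h4.comp g4⟩

lemma IsAut.id : IsAut (id : E → E) :=
  ⟨differentiable_id, _root_.id, differentiable_id, fun _ => rfl, fun _ => rfl⟩

lemma IsAut.iterate {T : E → E} (hT : IsAut T) (n : ℕ) : IsAut (T^[n]) := by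
  induction n with
  | zero => exact IsAut.id
  | succ n ih => exact ih.comp hT

lemma isAut_affine (c : ℂ) (hc : c ≠ 0) (a b : E) : IsAut (fun z => a + c • (z - b)) := by
  refine ⟨by fun_prop, fun z => b + c⁻¹ • (z - a), by fun_prop, fun z => ?_, fun z => ?_⟩
  · simp [smul_smul, hc]
  · simp [smul_smul, hc]

lemma IsAut.exists_inv {T : E → E} (hT : IsAut T) : ∃ S, IsAut S ∧ (∀ z, S (T z) = z) ∧
    ∀ z, T (S z) = z := by
  obtain ⟨h1, T', h2, h3, h4⟩ := hT
  exact ⟨T', ⟨h2, T, h1, h4, h3⟩, h3, h4⟩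

def Gen (V : E → E) : Prop :=
  ∀ K : Set E, IsCompact K → ∀ ε > (0 : ℝ), ∀ᶠ h : ℝ in 𝓝[>] (0 : ℝ),
    ∃ T : E → E, IsAut T ∧ ∀ z ∈ K, ‖T z - z - (h : ℂ) • V z‖ ≤ ε * h

lemma ev_small {a : ℝ} (ha : 0 < a) : ∀ᶠ h in 𝓝[>] (0 : ℝ), 0 < h ∧ h < a := by
  filter_upwards [Ioo_mem_nhdsGT ha] with h hh using hh

lemma gen_zero : Gen (fun _ : E => (0 : E)) := by
  intro K _ ε hε
  filter_upwards [ev_small one_pos] with h hh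
  exact ⟨id, IsAut.id, fun z _ => by simp; nlinarith⟩

lemma gen_limit {V : E → E}
    (H : ∀ K : Set E, IsCompact K → ∀ ε > (0 : ℝ), ∃ W, Gen W ∧ ∀ z ∈ K, ‖W z - V z‖ ≤ ε) :
    Gen V := by
  intro K hK ε hε
  obtain ⟨W, hW, hWV⟩ := H K hK (ε / 2) (by positivity)
  filter_upwards [hW K hK (ε / 2) (by positivity), ev_small one_pos] with h ⟨T, hT, hTK⟩ hh
  refine ⟨T, hT, fun z hz => ?_⟩
  have e : T z - z - (h : ℂ) • V z = (T z - z - (h : ℂ) • W z) + (h : ℂ) • (W z - V z) := by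
    rw [smul_sub]; abel
  rw [e]
  refine (norm_add_le _ _).trans ?_
  rw [norm_smul, Complex.norm_real, Real.norm_of_nonneg hh.1.le]
  have := hTK z hz
  have := mul_le_mul_of_nonneg_left (hWV z hz) hh.1.le
  linarith

lemma gen_add [ProperSpace E] {V W : E → E} (hVc : Continuous V) (hWc : Continuous W)
    (hV : Gen V) (hW : Gen W) : Gen (fun z => V z + W z) := by
  intro K hK ε hε
  obtain ⟨M, hM⟩ := hK.exists_bound_of_continuousOn hWc.continuousOn
  set K1 := cthickening 1 K with hK1
  have hK1c : IsCompact K1 := hK.cthickening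
  have huc := hK1c.uniformContinuousOn_of_continuous hVc.continuousOn
  rw [Metric.uniformContinuousOn_iff] at huc
  obtain ⟨δ, hδ, hδV⟩ := huc (ε / 3) (by positivity)
  have hM0 : 0 < |M| + ε / 3 := by positivity
  filter_upwards [hV K1 hK1c (ε / 3) (by positivity), hW K hK (ε / 3) (by positivity),
    ev_small (show 0 < min δ 1 / (|M| + ε / 3) by positivity)] with h ⟨T, hT, hTK⟩ ⟨S, hS, hSK⟩ ⟨h0, h1⟩
  refine ⟨T ∘ S, hT.comp hS, fun z hz => ?_⟩
  rw [lt_div_iff₀ hM0] at h1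
  have hSz := hSK z hz
  have hS1 : ‖S z - z‖ < min δ 1 := by
    have e : S z - z = (S z - z - (h : ℂ) • W z) + (h : ℂ) • W z := by abel
    rw [e]
    refine (norm_add_le _ _).trans_lt ?_
    rw [norm_smul, Complex.norm_real, Real.norm_of_nonneg h0.le]
    have := mul_le_mul_of_nonneg_left ((hM z hz).trans (le_abs_self M)) h0.le
    linarith
  have hzK1 : z ∈ K1 := self_subset_cthickening K hz
  have hSK1 : S z ∈ K1 := by
    refine mem_cthickening_of_dist_le _ z _ _ hz ?_
    rw [dist_eq_norm]
    exact (hS1.trans_le (min_le_right _ _)).le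
  have hVV := hδV (S z) hSK1 z hzK1 (by rw [dist_eq_norm]; exact hS1.trans_le (min_le_left _ _))
  rw [dist_eq_norm] at hVV
  have e : (T ∘ S) z - z - (h : ℂ) • (V z + W z) = (T (S z) - S z - (h : ℂ) • V (S z))
      + (S z - z - (h : ℂ) • W z) + (h : ℂ) • (V (S z) - V z) := by
    simp only [Function.comp, smul_add, smul_sub]; abel
  rw [e]
  refine (norm_add₃_le).trans ?_
  rw [norm_smul, Complex.norm_real, Real.norm_of_nonneg h0.le]
  have := mul_le_mul_of_nonneg_left hVV.le h0.le
  have := hTK (S z) hSK1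
  linarith

lemma gen_sum [ProperSpace E] {ι : Type*} (s : Finset ι) (V : ι → E → E)
    (hc : ∀ i, Continuous (V i)) (hV : ∀ i, Gen (V i)) : Gen (fun z => ∑ i ∈ s, V i z) := by
  classical
  induction s using Finset.induction_on with
  | empty => simpa using gen_zero
  | insert i s hi ih =>
    simp only [Finset.sum_insert hi]
    exact gen_add (hc i) (by fun_prop) (hV i) ih

lemma gen_shear (lam : E →L[ℂ] ℂ) (v : E) (h0 : lam v = 0) :
    Gen (fun z => Complex.exp (lam z) • v) := by
  intro K _ ε hε
  filter_upwards [ev_small one_pos] with h hh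
  refine ⟨fun z => z + (h : ℂ) • (Complex.exp (lam z) • v), ⟨by fun_prop,
    fun z => z - (h : ℂ) • (Complex.exp (lam z) • v), by fun_prop, fun z => ?_, fun z => ?_⟩,
    fun z _ => ?_⟩
  · simp [h0]
  · simp [h0]
  · simp; nlinarith

lemma gen_overshear (lam μ : E →L[ℂ] ℂ) (e : E) (h0 : lam e = 0) (hc : μ e ≠ 0) :
    Gen (fun z => (μ z * Complex.exp (lam z)) • e) := by
  intro K hK ε hε
  set c := μ e with hcdef
  obtain ⟨M, hM⟩ := hK.exists_bound_of_continuousOn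
    (f := fun z => c * Complex.exp (lam z)) (by fun_prop)
  obtain ⟨N, hN⟩ := hK.exists_bound_of_continuousOn
    (f := fun z => (c⁻¹ * μ z) • e) (by fun_prop)
  have hinv : ∀ (h : ℂ) (z : E),
      (z + ((Complex.exp (h * (c * Complex.exp (lam z))) - 1) * (c⁻¹ * μ z)) • e) +
      ((Complex.exp (-h * (c * Complex.exp (lam (z + ((Complex.exp (h * (c * Complex.exp (lam z))) - 1)
        * (c⁻¹ * μ z)) • e)))) - 1) * (c⁻¹ * μ (z +
          ((Complex.exp (h * (c * Complex.exp (lam z))) - 1) * (c⁻¹ * μ z)) • e))) • e = z := by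
    intro h z
    have e1 : lam (z + ((Complex.exp (h * (c * Complex.exp (lam z))) - 1) * (c⁻¹ * μ z)) • e)
        = lam z := by simp [h0]
    have e2 : c⁻¹ * μ (z + ((Complex.exp (h * (c * Complex.exp (lam z))) - 1) * (c⁻¹ * μ z)) • e)
        = Complex.exp (h * (c * Complex.exp (lam z))) * (c⁻¹ * μ z) := by
      rw [map_add, map_smul, ← hcdef, smul_eq_mul]
      field_simp
      ring
    rw [e1, e2, neg_mul, Complex.exp_neg, add_assoc, ← add_smul]
    have : Complex.exp (h * (c * Complex.exp (lam z))) ≠ 0 := Complex.exp_ne_zero _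
    have e3 : (Complex.exp (h * (c * Complex.exp (lam z))) - 1) * (c⁻¹ * μ z) +
      ((Complex.exp (h * (c * Complex.exp (lam z))))⁻¹ - 1) *
        (Complex.exp (h * (c * Complex.exp (lam z))) * (c⁻¹ * μ z)) = 0 := by
      field_simp; ring
    rw [e3]; simp
  filter_upwards [ev_small one_pos, ev_small (show 0 < 1 / (|M| + 1) by positivity),
    ev_small (show 0 < ε / ((|M| ^ 2 + 1) * (|N| + 1)) by positivity)] with h hh hh2 hh3
  refine ⟨fun z => z + ((Complex.exp (h * (c * Complex.exp (lam z))) - 1) * (c⁻¹ * μ z)) • e,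
    ⟨by fun_prop, fun z => z + ((Complex.exp (-h * (c * Complex.exp (lam z))) - 1)
      * (c⁻¹ * μ z)) • e, by fun_prop, fun z => hinv h z, fun z => ?_⟩,
    fun z hz => ?_⟩
  · have := hinv (-h) z
    simpa only [neg_neg] using this
  · have hMz : ‖c * Complex.exp (lam z)‖ ≤ |M| := (hM z hz).trans (le_abs_self _)
    have hNz : ‖(c⁻¹ * μ z) • e‖ ≤ |N| := (hN z hz).trans (le_abs_self _)
    set w := c * Complex.exp (lam z) with hw
    have hw1 : ‖(h : ℂ) * w‖ ≤ h * |M| := by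
      rw [norm_mul, Complex.norm_real, Real.norm_of_nonneg hh.1.le]
      exact mul_le_mul_of_nonneg_left hMz hh.1.le
    have hle : h * |M| ≤ 1 := by
      have := (lt_div_iff₀ (show 0 < |M| + 1 by positivity)).1 hh2.2
      nlinarith [hh.1]
    have hexp := Complex.norm_exp_sub_one_sub_id_le (x := (h : ℂ) * w) (hw1.trans hle)
    have e1 : z + ((Complex.exp (h * w) - 1) * (c⁻¹ * μ z)) • e - z
        - (h : ℂ) • ((μ z * Complex.exp (lam z)) • e)
        = (Complex.exp (h * w) - 1 - h * w) • ((c⁻¹ * μ z) • e) := by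
      rw [add_sub_cancel_left, smul_smul, ← sub_smul, smul_smul]
      congr 1
      rw [hw]
      field_simp
    show ‖z + ((Complex.exp (h * w) - 1) * (c⁻¹ * μ z)) • e - z
        - (h : ℂ) • ((μ z * Complex.exp (lam z)) • e)‖ ≤ ε * h
    rw [e1, norm_smul]
    have h3 := (lt_div_iff₀ (show 0 < (|M| ^ 2 + 1) * (|N| + 1) by positivity)).1 hh3.2
    have h4 : ‖(h : ℂ) * w‖ ^ 2 ≤ (h * |M|) ^ 2 := by gcongr
    calc _ ≤ (h * |M|) ^ 2 * |N| := by
          apply mul_le_mul (hexp.trans h4) hNz (norm_nonneg _) (by positivity)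
      _ = h * (h * (|M| ^ 2 * |N|)) := by ring
      _ ≤ h * (h * ((|M| ^ 2 + 1) * (|N| + 1))) := by
          have := hh.1
          gcongr <;> linarith
      _ ≤ ε * h := by rw [mul_comm ε]; exact mul_le_mul_of_nonneg_left h3.le hh.1.le

end P6

open Metric Set Filter Topology
set_option autoImplicit false
section P7
variable {E : Type*} [NormedAddCommGroup E] [NormedSpace ℂ E]

lemma gen_exp [FiniteDimensional ℂ E] (hdim : 2 ≤ Module.finrank ℂ E) (lam : E →L[ℂ] ℂ) (v : E) :
    Gen (fun z => Complex.exp (lam z) • v) := by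
  have : ProperSpace E := FiniteDimensional.proper ℂ E
  by_cases hc : lam v = 0
  · exact gen_shear lam v hc
  obtain ⟨e, he, he0⟩ : ∃ w, lam w = 0 ∧ w ≠ 0 := by
    have := LinearMap.ker_ne_bot_of_finrank_lt (f := (lam : E →ₗ[ℂ] ℂ)) (by simp; omega)
    obtain ⟨w, hw, hw0⟩ := Submodule.exists_mem_ne_zero_of_ne_bot this
    exact ⟨w, by simpa using hw, hw0⟩
  obtain ⟨ν, hν⟩ := SeparatingDual.exists_eq_one (R := ℂ) he0
  set μ : E →L[ℂ] ℂ := lam v • ν - ν v • lam with hμ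
  have hμe : μ e = lam v := by simp [hμ, hν, he]
  have hμv : μ v = 0 := by simp [hμ]; ring
  have h1 : Gen (fun z => Complex.exp (lam z) • v - (μ z * Complex.exp (lam z)) • e) := by
    apply gen_limit
    intro K hK ε hε
    obtain ⟨M, hM⟩ := hK.exists_bound_of_continuousOn (f := fun z => μ z) (by fun_prop)
    obtain ⟨N, hN⟩ := hK.exists_bound_of_continuousOn
      (f := fun z => Complex.exp (lam z) • v) (by fun_prop)
    obtain ⟨Q, hQ⟩ := hK.exists_bound_of_continuousOn
      (f := fun z => Complex.exp (lam z) • e) (by fun_prop)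
    obtain ⟨b, ⟨⟨hb0, hb1⟩, -, hb2⟩⟩ := ((ev_small (show 0 < 1 / (|M| + 1) by positivity)).and
      (ev_small (show 0 < ε / (2 * (|M| + 1) * (|N| + 1) + (|M| ^ 2 + 1) * (|Q| + 1))
        by positivity))).exists
    have hbc : (b : ℂ) ≠ 0 := by exact_mod_cast hb0.ne'
    refine ⟨fun z => Complex.exp ((lam + (b : ℂ) • μ) z) • (v - (b : ℂ)⁻¹ • e)
      + Complex.exp (lam z) • ((b : ℂ)⁻¹ • e),
      gen_add (by fun_prop) (by fun_prop) (gen_shear _ _ ?_) (gen_shear _ _ ?_), ?_⟩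
    · simp [hμe, hμv, he, hbc]
    · simp [he]
    · intro z hz
      have hMz : ‖μ z‖ ≤ |M| := (hM z hz).trans (le_abs_self _)
      have hNz : ‖Complex.exp (lam z) • v‖ ≤ |N| := (hN z hz).trans (le_abs_self _)
      have hQz : ‖Complex.exp (lam z) • e‖ ≤ |Q| := (hQ z hz).trans (le_abs_self _)
      set w := (b : ℂ) * μ z with hw
      have hw1 : ‖w‖ ≤ b * |M| := by
        rw [norm_mul, Complex.norm_real, Real.norm_of_nonneg hb0.le]
        exact mul_le_mul_of_nonneg_left hMz hb0.le
      have hle : b * |M| ≤ 1 := by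
        have := (lt_div_iff₀ (show 0 < |M| + 1 by positivity)).1 hb1
        nlinarith
      have hexp := Complex.norm_exp_sub_one_sub_id_le (x := w) (hw1.trans hle)
      have hexp1 := Complex.norm_exp_sub_one_le (x := w) (hw1.trans hle)
      have e1 : Complex.exp ((lam + (b : ℂ) • μ) z) • (v - (b : ℂ)⁻¹ • e)
          + Complex.exp (lam z) • ((b : ℂ)⁻¹ • e)
          - (Complex.exp (lam z) • v - (μ z * Complex.exp (lam z)) • e)
          = (Complex.exp w - 1) • (Complex.exp (lam z) • v)
            - ((b : ℂ)⁻¹ * (Complex.exp w - 1 - w)) • (Complex.exp (lam z) • e) := by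
        have : Complex.exp ((lam + (b : ℂ) • μ) z) = Complex.exp (lam z) * Complex.exp w := by
          rw [← Complex.exp_add]; simp [hw]
        have hμz : μ z = (b : ℂ)⁻¹ * w := by rw [hw]; field_simp
        rw [this, hμz]
        module
      rw [e1]
      refine (norm_sub_le _ _).trans ?_
      rw [norm_smul (Complex.exp w - 1), norm_smul ((b : ℂ)⁻¹ * _), norm_mul, norm_inv, Complex.norm_real, Real.norm_of_nonneg hb0.le]
      have h3 := (lt_div_iff₀ (by positivity)).1 hb2
      have p1 : ‖Complex.exp w - 1‖ * ‖Complex.exp (lam z) • v‖ ≤ (2 * (b * |M|)) * |N| :=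
        mul_le_mul (by linarith) hNz (norm_nonneg _) (by positivity)
      have p2 : b⁻¹ * ‖Complex.exp w - 1 - w‖ * ‖Complex.exp (lam z) • e‖
          ≤ (b⁻¹ * (b * |M|) ^ 2) * |Q| := by
        refine mul_le_mul (mul_le_mul_of_nonneg_left (hexp.trans (by gcongr)) (by positivity)) hQz
          (norm_nonneg _) (by positivity)
      have p3 : b⁻¹ * (b * |M|) ^ 2 = b * |M| ^ 2 := by field_simp
      rw [p3] at p2
      have p4 : 2 * (b * |M|) * |N| ≤ b * (2 * (|M| + 1) * (|N| + 1)) := by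
        have : |M| * |N| ≤ (|M| + 1) * (|N| + 1) := by gcongr <;> linarith
        nlinarith
      have p5 : b * |M| ^ 2 * |Q| ≤ b * ((|M| ^ 2 + 1) * (|Q| + 1)) := by
        have : |M| ^ 2 * |Q| ≤ (|M| ^ 2 + 1) * (|Q| + 1) := by gcongr <;> linarith
        nlinarith
      nlinarith
  have h2 := gen_overshear lam μ e he (by rw [hμe]; exact hc)
  have h3 := gen_add (by fun_prop) (by fun_prop) h1 h2
  simpa using h3

def expSet (E : Type*) [NormedAddCommGroup E] [NormedSpace ℂ E] : Set (E → ℂ) :=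
  range fun lam : E →L[ℂ] ℂ => fun z => Complex.exp (lam z)

lemma expAlg_gen [FiniteDimensional ℂ E] (hdim : 2 ≤ Module.finrank ℂ E) {g : E → ℂ}
    (hg : g ∈ Algebra.adjoin ℂ (expSet E)) :
    Continuous g ∧ ∀ v, Gen (fun z => g z • v) := by
  have : ProperSpace E := FiniteDimensional.proper ℂ E
  rw [← Subalgebra.mem_toSubmodule, Algebra.adjoin_eq_span] at hg
  induction hg using Submodule.span_induction with
  | mem g hg =>
    have : g ∈ expSet E := by
      induction hg using Submonoid.closure_induction with
      | mem g hg => exact hg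
      | one => exact ⟨0, by ext z; simp⟩
      | mul x y _ _ hx hy =>
        obtain ⟨a, rfl⟩ := hx
        obtain ⟨b, rfl⟩ := hy
        exact ⟨a + b, by ext z; simp [Complex.exp_add]⟩
    obtain ⟨a, rfl⟩ := this
    exact ⟨by fun_prop, fun v => gen_exp hdim a v⟩
  | zero => exact ⟨continuous_zero, fun v => by simpa using gen_zero⟩
  | add x y _ _ hx hy =>
    have h1 := hx.1
    have h2 := hy.1
    refine ⟨hx.1.add hy.1, fun v => ?_⟩
    have := gen_add (by fun_prop) (by fun_prop) (hx.2 v) (hy.2 v)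
    simpa [add_smul] using this
  | smul c x _ hx =>
    have h1 := hx.1
    refine ⟨hx.1.const_smul c, fun v => ?_⟩
    have := hx.2 (c • v)
    simpa [smul_smul, mul_comm] using this

def ExpAp (f : E → ℂ) : Prop := Continuous f ∧ ∀ K : Set E, IsCompact K → ∀ ε > (0 : ℝ),
  ∃ g ∈ Algebra.adjoin ℂ (expSet E), ∀ z ∈ K, ‖f z - g z‖ ≤ ε

lemma expAp_const (c : ℂ) : ExpAp (fun _ : E => c) :=
  ⟨continuous_const, fun K _ ε hε => ⟨algebraMap ℂ (E → ℂ) c, Subalgebra.algebraMap_mem _ _,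
    fun z _ => by simp [hε.le]⟩⟩

lemma expAp_add {f g : E → ℂ} (hf : ExpAp f) (hg : ExpAp g) : ExpAp (fun z => f z + g z) := by
  refine ⟨hf.1.add hg.1, fun K hK ε hε => ?_⟩
  obtain ⟨f', hf', h1⟩ := hf.2 K hK (ε / 2) (by positivity)
  obtain ⟨g', hg', h2⟩ := hg.2 K hK (ε / 2) (by positivity)
  refine ⟨f' + g', add_mem hf' hg', fun z hz => ?_⟩
  have : f z + g z - (f' + g') z = (f z - f' z) + (g z - g' z) := by simp; ring
  rw [this]
  refine (norm_add_le _ _).trans ?_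
  linarith [h1 z hz, h2 z hz]

lemma expAp_mul {f g : E → ℂ} (hf : ExpAp f) (hg : ExpAp g) : ExpAp (fun z => f z * g z) := by
  refine ⟨hf.1.mul hg.1, fun K hK ε hε => ?_⟩
  obtain ⟨M, hM⟩ := hK.exists_bound_of_continuousOn hf.1.continuousOn
  obtain ⟨N, hN⟩ := hK.exists_bound_of_continuousOn hg.1.continuousOn
  have hδ : 0 < min 1 (ε / (|M| + |N| + 1)) := by positivity
  set δ := min 1 (ε / (|M| + |N| + 1)) with hδd
  obtain ⟨f', hf', h1⟩ := hf.2 K hK δ hδ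
  obtain ⟨g', hg', h2⟩ := hg.2 K hK δ hδ
  refine ⟨f' * g', mul_mem hf' hg', fun z hz => ?_⟩
  have hMz : ‖f z‖ ≤ |M| := (hM z hz).trans (le_abs_self _)
  have hNz : ‖g z‖ ≤ |N| := (hN z hz).trans (le_abs_self _)
  have : f z * g z - (f' * g') z = (f z - f' z) * g z + f z * (g z - g' z)
      - (f z - f' z) * (g z - g' z) := by simp; ring
  rw [this]
  have hδ1 : δ ≤ 1 := min_le_left _ _
  have hδ2 : δ * (|M| + |N| + 1) ≤ ε := by
    rw [← le_div_iff₀ (by positivity)]; exact min_le_right _ _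
  have q1 : ‖(f z - f' z) * g z‖ ≤ δ * |N| := by
    rw [norm_mul]; exact mul_le_mul (h1 z hz) hNz (norm_nonneg _) hδ.le
  have q2 : ‖f z * (g z - g' z)‖ ≤ |M| * δ := by
    rw [norm_mul]; exact mul_le_mul hMz (h2 z hz) (norm_nonneg _) (abs_nonneg _)
  have q3 : ‖(f z - f' z) * (g z - g' z)‖ ≤ δ * 1 := by
    rw [norm_mul]; exact mul_le_mul (h1 z hz) ((h2 z hz).trans hδ1) (norm_nonneg _) hδ.le
  refine (norm_sub_le _ _).trans ?_
  have := norm_add_le ((f z - f' z) * g z) (f z * (g z - g' z))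
  nlinarith

lemma expAp_lin (μ : E →L[ℂ] ℂ) : ExpAp (fun z => μ z) := by
  refine ⟨by fun_prop, fun K hK ε hε => ?_⟩
  obtain ⟨M, hM⟩ := hK.exists_bound_of_continuousOn (f := fun z => μ z) (by fun_prop)
  obtain ⟨b, ⟨⟨hb0, hb1⟩, -, hb2⟩⟩ := ((ev_small (show 0 < 1 / (|M| + 1) by positivity)).and
      (ev_small (show 0 < ε / (|M| ^ 2 + 1) by positivity))).exists
  have hbc : (b : ℂ) ≠ 0 := by exact_mod_cast hb0.ne'
  refine ⟨(b : ℂ)⁻¹ • ((fun z => Complex.exp (((b : ℂ) • μ) z)) - 1), ?_, fun z hz => ?_⟩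
  · exact Subalgebra.smul_mem _ (sub_mem (Algebra.subset_adjoin (s := expSet E) ⟨(b : ℂ) • μ, rfl⟩)
      (one_mem _)) _
  have hMz : ‖μ z‖ ≤ |M| := (hM z hz).trans (le_abs_self _)
  set w := (b : ℂ) * μ z with hw
  have hw1 : ‖w‖ ≤ b * |M| := by
    rw [norm_mul, Complex.norm_real, Real.norm_of_nonneg hb0.le]
    exact mul_le_mul_of_nonneg_left hMz hb0.le
  have hle : b * |M| ≤ 1 := by
    have := (lt_div_iff₀ (show 0 < |M| + 1 by positivity)).1 hb1
    nlinarith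
  have hexp := Complex.norm_exp_sub_one_sub_id_le (x := w) (hw1.trans hle)
  have hμz : μ z = (b : ℂ)⁻¹ * w := by rw [hw]; field_simp
  have e1 : μ z - ((b : ℂ)⁻¹ • ((fun z => Complex.exp (((b : ℂ) • μ) z)) - 1)) z
      = - ((b : ℂ)⁻¹ * (Complex.exp w - 1 - w)) := by
    have : ((b : ℂ) • μ) z = w := by simp [hw]
    simp only [Pi.smul_apply, Pi.sub_apply, Pi.one_apply, this, smul_eq_mul]
    rw [hμz]; ring
  rw [e1, norm_neg, norm_mul, norm_inv, Complex.norm_real, Real.norm_of_nonneg hb0.le]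
  have h3 := (lt_div_iff₀ (by positivity)).1 hb2
  calc b⁻¹ * ‖Complex.exp w - 1 - w‖ ≤ b⁻¹ * (b * |M|) ^ 2 :=
        mul_le_mul_of_nonneg_left (hexp.trans (by gcongr)) (by positivity)
    _ = b * |M| ^ 2 := by field_simp
    _ ≤ ε := by nlinarith

lemma expAp_poly {ι : Type*} (l : ι → E →L[ℂ] ℂ) (P : MvPolynomial ι ℂ) :
    ExpAp (fun z => MvPolynomial.eval (fun i => l i z) P) := by
  induction P using MvPolynomial.induction_on with
  | C a => simpa using expAp_const a
  | add p q hp hq => simpa using expAp_add hp hq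
  | mul_X p i hp => simpa using expAp_mul hp (expAp_lin (l i))

lemma gen_poly [FiniteDimensional ℂ E] (hdim : 2 ≤ Module.finrank ℂ E)
    {ι : Type*} (l : ι → E →L[ℂ] ℂ) (P : MvPolynomial ι ℂ) (v : E) :
    Gen (fun z => MvPolynomial.eval (fun i => l i z) P • v) := by
  apply gen_limit
  intro K hK ε hε
  obtain ⟨g, hg, hgK⟩ := (expAp_poly l P).2 K hK (ε / (‖v‖ + 1)) (by positivity)
  refine ⟨fun z => g z • v, (expAlg_gen hdim hg).2 v, fun z hz => ?_⟩
  rw [← sub_smul, norm_smul, norm_sub_rev]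
  have := (le_div_iff₀ (by positivity)).1 (hgK z hz)
  nlinarith [norm_nonneg (MvPolynomial.eval (fun i => l i z) P - g z)]

end P7

open Metric Set Filter Topology
set_option autoImplicit false
section P8
variable {E : Type*} [NormedAddCommGroup E] [NormedSpace ℂ E]

def RG (Ω : Set E) : Prop := ∀ V : E → E, DifferentiableOn ℂ V Ω → ∀ K ⊆ Ω, IsCompact K →
  ∀ ε > (0 : ℝ), ∃ W : E → E, Gen W ∧ ∀ z ∈ K, ‖W z - V z‖ ≤ ε

lemma one_step [FiniteDimensional ℂ E] {Ω : Set E} (hΩ : IsOpen Ω) (hRG : RG Ω) {F G : E → E}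
    (hF : Differentiable ℂ F) (hFΩ : ∀ z, F z ∈ Ω) (hGF : ∀ z, G (F z) = z)
    (hG : DifferentiableOn ℂ G Ω) {R ε : ℝ} (hR : 0 < R) (hε : 0 < ε) :
    ∀ᶠ h : ℝ in 𝓝[>] (0 : ℝ), ∃ T : E → E, IsAut T ∧ ∀ z, ‖z‖ ≤ R → T (F z) ∈ Ω ∧
      ‖G (T (F z)) - (1 - h : ℂ) • z‖ ≤ ε * h := by
  have : ProperSpace E := FiniteDimensional.proper ℂ E
  have : CompleteSpace E := FiniteDimensional.complete ℂ E
  set B := closedBall (0 : E) R with hB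
  have hBc : IsCompact B := isCompact_closedBall _ _
  have hKc : IsCompact (F '' B) := hBc.image hF.continuous
  have hKΩ : F '' B ⊆ Ω := by rintro _ ⟨z, -, rfl⟩; exact hFΩ z
  obtain ⟨δ, hδ, hδΩ⟩ := hKc.exists_cthickening_subset_open hΩ hKΩ
  have hK2c : IsCompact (cthickening δ (F '' B)) := hKc.cthickening
  have hDG : ContinuousOn (fderiv ℂ G) (cthickening δ (F '' B)) :=
    (hol_fderiv_continuousOn hΩ hG).mono hδΩ
  obtain ⟨L', hL'⟩ := hK2c.exists_bound_of_continuousOn hDG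
  set L := |L'| + 1 with hLdef
  have hL0 : 0 < L := by positivity
  have hL : ∀ y ∈ cthickening δ (F '' B), ‖fderiv ℂ G y‖ ≤ L := fun y hy =>
    (hL' y hy).trans ((le_abs_self _).trans (by linarith))
  set V : E → E := fun u => - fderiv ℂ F (G u) (G u) with hV
  have hDF : DifferentiableOn ℂ (fderiv ℂ F) univ :=
    hol_fderiv_differentiableOn isOpen_univ hF.differentiableOn
  have hVd : DifferentiableOn ℂ V Ω :=
    ((hDF.comp hG (fun _ _ => mem_univ _)).clm_apply hG).neg
  set ε1 := ε / (4 * L) with hε1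
  set ε2 := ε / (2 * L * (R + 1)) with hε2
  have hε1p : 0 < ε1 := by positivity
  have hε2p : 0 < ε2 := by positivity
  obtain ⟨W, hW, hWV⟩ := hRG V hVd _ hKΩ hKc ε1 hε1p
  obtain ⟨M', hM'⟩ := hKc.exists_bound_of_continuousOn (hVd.continuousOn.mono hKΩ)
  set M := |M'| with hMdef
  have hM : ∀ z ∈ B, ‖V (F z)‖ ≤ M := fun z hz =>
    (hM' _ (mem_image_of_mem F hz)).trans (le_abs_self _)
  have hM0 : 0 ≤ M := abs_nonneg _
  have hDFc : ContinuousOn (fderiv ℂ F) B := hDF.continuousOn.mono (subset_univ _)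
  have huc := hBc.uniformContinuousOn_of_continuous hDFc
  rw [Metric.uniformContinuousOn_iff] at huc
  obtain ⟨δ1, hδ1, hucδ⟩ := huc ε2 hε2p
  filter_upwards [hW _ hKc ε1 hε1p, ev_small one_pos, ev_small (show 0 < δ1 / (R + 1) by positivity),
    ev_small (show 0 < δ / (2 * ε1 + ε2 * R + M + 1) by positivity)]
    with h ⟨T, hT, hTK⟩ ⟨h0, h1⟩ ⟨_, h2⟩ ⟨_, h3⟩
  rw [lt_div_iff₀ (by positivity)] at h2 h3
  refine ⟨T, hT, fun z hz => ?_⟩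
  have hzB : z ∈ B := by simpa [hB] using hz
  have hVz : V (F z) = - fderiv ℂ F z z := by simp [hV, hGF]
  -- estimate for `T`
  have hT1 : ‖T (F z) - F z - (h : ℂ) • V (F z)‖ ≤ 2 * ε1 * h := by
    have e : T (F z) - F z - (h : ℂ) • V (F z) = (T (F z) - F z - (h : ℂ) • W (F z))
        + (h : ℂ) • (W (F z) - V (F z)) := by rw [smul_sub]; abel
    rw [e]
    refine (norm_add_le _ _).trans ?_
    rw [norm_smul, Complex.norm_real, Real.norm_of_nonneg h0.le]
    have a1 := hTK _ (mem_image_of_mem F hzB)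
    have a2 := mul_le_mul_of_nonneg_left (hWV _ (mem_image_of_mem F hzB)) h0.le
    linarith
  -- estimate for `F`
  set w := (1 - h : ℂ) • z with hw
  have hwz : w - z = -((h : ℂ) • z) := by rw [hw]; module
  have hwzn : ‖w - z‖ ≤ h * R := by
    rw [hwz, norm_neg, norm_smul, Complex.norm_real, Real.norm_of_nonneg h0.le]
    exact mul_le_mul_of_nonneg_left hz h0.le
  have hwB : w ∈ B := by
    have : (1 - h : ℂ) = ((1 - h : ℝ) : ℂ) := by push_cast; ring
    rw [hB, mem_closedBall_zero_iff, hw, norm_smul, this, Complex.norm_real,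
      Real.norm_of_nonneg (by linarith)]
    nlinarith [norm_nonneg z]
  have hF1 : ‖F w - F z - (h : ℂ) • V (F z)‖ ≤ ε2 * R * h := by
    have hcv : Convex ℝ (ball z δ1 ∩ B) := (convex_ball _ _).inter (convex_closedBall _ _)
    have hwm : w ∈ ball z δ1 ∩ B := by
      refine ⟨?_, hwB⟩
      rw [mem_ball, dist_eq_norm]
      nlinarith
    have := hcv.norm_image_sub_le_of_norm_hasFDerivWithin_le' (𝕜 := ℂ) (f := F)
      (f' := fderiv ℂ F) (φ := fderiv ℂ F z) (C := ε2) (x := z) (y := w)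
      (fun x _ => (hF x).hasFDerivAt.hasFDerivWithinAt)
      (fun x hx => by
        rw [← dist_eq_norm]
        exact (hucδ x hx.2 z hzB hx.1).le) ⟨mem_ball_self hδ1, hzB⟩ hwm
    have e : F w - F z - (h : ℂ) • V (F z) = F w - F z - fderiv ℂ F z (w - z) := by
      rw [hwz, hVz]; simp
    rw [e]
    refine this.trans ?_
    nlinarith
  have hhV : ‖(h : ℂ) • V (F z)‖ ≤ h * M := by
    rw [norm_smul, Complex.norm_real, Real.norm_of_nonneg h0.le]
    exact mul_le_mul_of_nonneg_left (hM z hzB) h0.le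
  have hcb : closedBall (F z) δ ⊆ cthickening δ (F '' B) :=
    closedBall_subset_cthickening (mem_image_of_mem F hzB) δ
  have hm1 : T (F z) ∈ closedBall (F z) δ := by
    rw [mem_closedBall, dist_eq_norm]
    have e : T (F z) - F z = (T (F z) - F z - (h : ℂ) • V (F z)) + (h : ℂ) • V (F z) := by abel
    rw [e]
    refine (norm_add_le _ _).trans ?_
    nlinarith [mul_pos (mul_pos hε2p hR) h0]
  have hm2 : F w ∈ closedBall (F z) δ := by
    rw [mem_closedBall, dist_eq_norm]
    have e : F w - F z = (F w - F z - (h : ℂ) • V (F z)) + (h : ℂ) • V (F z) := by abel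
    rw [e]
    refine (norm_add_le _ _).trans ?_
    nlinarith [mul_pos hε1p h0]
  refine ⟨hδΩ (hcb hm1), ?_⟩
  have hlip := (convex_closedBall (F z) δ).norm_image_sub_le_of_norm_fderiv_le (𝕜 := ℂ) (f := G)
    (C := L) (fun x hx => (hG x (hδΩ (hcb hx))).differentiableAt (hΩ.mem_nhds (hδΩ (hcb hx))))
    (fun x hx => hL x (hcb hx)) hm2 hm1
  rw [hGF] at hlip
  refine hlip.trans ?_
  have e : T (F z) - F w = (T (F z) - F z - (h : ℂ) • V (F z))
      - (F w - F z - (h : ℂ) • V (F z)) := by abel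
  have hn : ‖T (F z) - F w‖ ≤ (2 * ε1 + ε2 * R) * h := by
    rw [e]
    refine (norm_sub_le _ _).trans ?_
    linarith
  have hfin : L * (2 * ε1 + ε2 * R) ≤ ε := by
    have q1 : L * (2 * ε1) = ε / 2 := by rw [hε1]; field_simp; ring
    have q2 : L * (ε2 * (R + 1)) = ε / 2 := by rw [hε2]; field_simp
    nlinarith [mul_pos hL0 hε2p]
  calc L * ‖T (F z) - F w‖ ≤ L * ((2 * ε1 + ε2 * R) * h) := by gcongr
    _ = L * (2 * ε1 + ε2 * R) * h := by ring
    _ ≤ ε * h := by gcongr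

lemma key_approx [FiniteDimensional ℂ E] {Ω : Set E} (hΩ : IsOpen Ω) (hRG : RG Ω) {F G : E → E}
    {p : E} (hF : Differentiable ℂ F) (hFΩ : ∀ z, F z ∈ Ω) (hGF : ∀ z, G (F z) = z)
    (hFG : ∀ u ∈ Ω, F (G u) = u)
    (hG : DifferentiableOn ℂ G Ω) (hF0 : F 0 = p)
    (hF0' : HasFDerivAt F (ContinuousLinearMap.id ℂ E) 0) {R ε : ℝ} (hR : 0 < R) (hε : 0 < ε) :
    ∃ χ : E → E, IsAut χ ∧ χ p = 0 ∧ ∀ z, ‖z‖ ≤ R → ‖χ (F z) - z‖ ≤ ε := by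
  set η := min 1 (ε / 4) with hη
  have hη0 : 0 < η := by positivity
  have hη1 : η ≤ 1 := min_le_left _ _
  have hη2 : η ≤ ε / 4 := min_le_right _ _
  set δ := ε / (4 * (R + 1)) with hδ
  have hδ0 : 0 < δ := by positivity
  obtain ⟨r0, hr0, hr0F⟩ : ∃ r0 > 0, ∀ w : E, ‖w‖ < r0 → ‖F w - p - w‖ ≤ δ * ‖w‖ := by
    have := hF0'.isLittleO.def hδ0
    obtain ⟨r0, hr0, hs⟩ := Metric.eventually_nhds_iff.1 this
    refine ⟨r0, hr0, fun w hw => ?_⟩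
    simpa [hF0] using hs (y := w) (by simpa using hw)
  obtain ⟨s, hs0, hs⟩ : ∃ s > 0, Real.exp (-s) * (R + 1) < r0 := by
    have h1 : Tendsto (fun s : ℝ => Real.exp (-s) * (R + 1)) atTop (𝓝 (0 * (R + 1))) :=
      (Real.tendsto_exp_neg_atTop_nhds_zero).mul_const _
    rw [zero_mul] at h1
    obtain ⟨s, h2, h3⟩ := ((h1.eventually (gt_mem_nhds hr0)).and (eventually_gt_atTop 0)).exists
    exact ⟨s, h3, h2⟩
  set ε' := Real.exp (-s) / 2 * η / s with hε'
  have hε'0 : 0 < ε' := by positivity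
  have hstep := one_step hΩ hRG hF hFΩ hGF hG (show 0 < R + 1 by linarith) hε'0
  have hN1 : Tendsto (fun N : ℕ => s / N) atTop (𝓝[>] 0) := by
    rw [tendsto_nhdsWithin_iff]
    refine ⟨tendsto_const_div_atTop_nhds_zero_nat s, ?_⟩
    filter_upwards [eventually_gt_atTop 0] with N hN
    have : (0 : ℝ) < N := by exact_mod_cast hN
    exact div_pos hs0 this
  have hN2 : Tendsto (fun N : ℕ => (1 + (-s) / N) ^ N) atTop (𝓝 (Real.exp (-s))) :=
    Real.tendsto_one_add_div_pow_exp (-s)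
  have hN3 := hN2.eventually (lt_mem_nhds (show Real.exp (-s) / 2 < Real.exp (-s) by
    linarith [Real.exp_pos (-s)]))
  obtain ⟨N, ⟨⟨⟨T, hT, hTz⟩, hc1⟩, hsN⟩, hN0⟩ := (((hN1.eventually hstep).and hN3).and
    (eventually_ge_atTop ⌈s⌉₊)).and (eventually_gt_atTop 0) |>.exists
  have hNp : (0 : ℝ) < N := by exact_mod_cast hN0
  have hsN' : s ≤ N := Nat.ceil_le.1 hsN
  set h := s / N with hh
  have hh0 : 0 < h := div_pos hs0 hNp
  have hh1 : h ≤ 1 := by rw [hh, div_le_one hNp]; exact hsN'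
  have hNh : N * h = s := by rw [hh]; field_simp
  set c := (1 - h) ^ N with hc
  have hcl : Real.exp (-s) / 2 < c := by
    have : 1 + -s / (N : ℝ) = 1 - h := by rw [hh]; ring
    rw [this] at hc1; exact hc1
  have hcu : c ≤ Real.exp (-s) := Real.one_sub_div_pow_le_exp_neg hsN'
  have hc0 : 0 < c := lt_trans (by positivity) hcl
  have hcη : s * ε' ≤ c * η := by
    have : s * ε' = Real.exp (-s) / 2 * η := by rw [hε']; field_simp
    rw [this]; gcongr
  have hc1' : c ≤ 1 := hcu.trans (by rw [Real.exp_le_one_iff]; linarith)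
  -- iteration
  have hiter : ∀ z, ‖z‖ ≤ R → ∀ j ≤ N, ∃ w, T^[j] (F z) = F w ∧
      ‖w - ((1 - h : ℂ) ^ j) • z‖ ≤ j * (ε' * h) := by
    intro z hz j
    induction j with
    | zero => intro _; exact ⟨z, rfl, by simp⟩
    | succ j ih =>
      intro hj
      obtain ⟨w, hw1, hw2⟩ := ih (by omega)
      have hcast : (1 - h : ℂ) = ((1 - h : ℝ) : ℂ) := by push_cast; ring
      have hjN : (j : ℝ) + 1 ≤ N := by exact_mod_cast hj
      have hn1 : ‖(1 - h : ℂ)‖ ≤ 1 := by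
        rw [hcast, Complex.norm_real, Real.norm_of_nonneg (by linarith)]; linarith
      have hwn : ‖w‖ ≤ R + 1 := by
        have e : w = (w - ((1 - h : ℂ) ^ j) • z) + ((1 - h : ℂ) ^ j) • z := by abel
        have b1 : ‖((1 - h : ℂ) ^ j) • z‖ ≤ R := by
          rw [norm_smul, norm_pow]
          have := pow_le_one₀ (n := j) (norm_nonneg _) hn1
          nlinarith [norm_nonneg z]
        have b2 : (j : ℝ) * (ε' * h) ≤ 1 := by
          have : (j : ℝ) * (ε' * h) ≤ N * (ε' * h) := by gcongr; linarith
          have e2 : (N : ℝ) * (ε' * h) = s * ε' := by rw [← hNh]; ring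
          nlinarith
        rw [e]
        exact (norm_add_le _ _).trans (by linarith)
      obtain ⟨m1, m2⟩ := hTz w hwn
      refine ⟨G (T (F w)), ?_, ?_⟩
      · rw [Function.iterate_succ_apply', hw1, hFG _ m1]
      · have e : G (T (F w)) - ((1 - h : ℂ) ^ (j + 1)) • z = (G (T (F w)) - (1 - h : ℂ) • w)
            + (1 - h : ℂ) • (w - ((1 - h : ℂ) ^ j) • z) := by
          rw [pow_succ']; module
        rw [e]
        refine (norm_add_le _ _).trans ?_
        rw [norm_smul]
        have := mul_le_mul hn1 hw2 (norm_nonneg _) zero_le_one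
        push_cast
        linarith
  have hTN : ∀ z, ‖z‖ ≤ R → ‖(c : ℂ)⁻¹ • (T^[N] (F z) - p) - z‖ ≤ ε / 2 := by
    intro z hz
    obtain ⟨w, hw1, hw2⟩ := hiter z hz N le_rfl
    have hcc : ((1 - h : ℂ) ^ N) = (c : ℂ) := by rw [hc]; push_cast; ring
    rw [hcc] at hw2
    have e2 : (N : ℝ) * (ε' * h) = s * ε' := by rw [← hNh]; ring
    have hw3 : ‖w - (c : ℂ) • z‖ ≤ c * η := by linarith
    have hcz : ‖(c : ℂ) • z‖ ≤ c * R := by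
      rw [norm_smul, Complex.norm_real, Real.norm_of_nonneg hc0.le]; gcongr
    have hwn : ‖w‖ ≤ c * (R + 1) := by
      have e : w = (w - (c : ℂ) • z) + (c : ℂ) • z := by abel
      rw [e]
      refine (norm_add_le _ _).trans ?_
      nlinarith
    have hFw := hr0F w (hwn.trans_lt (lt_of_le_of_lt (by gcongr) hs))
    have hcne : (c : ℂ) ≠ 0 := by exact_mod_cast hc0.ne'
    have e : (c : ℂ)⁻¹ • (T^[N] (F z) - p) - z
        = (c : ℂ)⁻¹ • ((F w - p - w) + (w - (c : ℂ) • z)) := by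
      rw [hw1, smul_add, smul_sub _ w, smul_smul, inv_mul_cancel₀ hcne, smul_sub _ (F w - p)]
      simp
    rw [e, norm_smul, norm_inv, Complex.norm_real, Real.norm_of_nonneg hc0.le,
      inv_mul_le_iff₀ hc0]
    refine (norm_add_le _ _).trans ?_
    have q : δ * (R + 1) = ε / 4 := by rw [hδ]; field_simp
    have q2 : δ * ‖w‖ ≤ δ * (c * (R + 1)) := by gcongr
    nlinarith
  have hp0 := hTN 0 (by simpa using hR.le)
  rw [hF0, sub_zero] at hp0
  set q := T^[N] p with hq
  have hcne : (c : ℂ)⁻¹ ≠ 0 := inv_ne_zero (by exact_mod_cast hc0.ne')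
  refine ⟨fun u => 0 + (c : ℂ)⁻¹ • (T^[N] u - q), (isAut_affine _ hcne 0 q).comp (hT.iterate N),
    by simp [hq], fun z hz => ?_⟩
  have e : 0 + (c : ℂ)⁻¹ • (T^[N] (F z) - q) - z
      = ((c : ℂ)⁻¹ • (T^[N] (F z) - p) - z) - (c : ℂ)⁻¹ • (q - p) := by
    module
  simp only [e]
  refine (norm_sub_le _ _).trans ?_
  linarith [hTN z hz]

end P8

open Metric Set Filter Topology
set_option autoImplicit false
section P9
variable {E : Type*} [NormedAddCommGroup E] [NormedSpace ℂ E]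

lemma surj_near [FiniteDimensional ℂ E] {f : E → E} (hf : Differentiable ℂ f) {R ε : ℝ}
    (hR : 0 < R) (hεR : ε ≤ R / 1000) (hfε : ∀ z, ‖z‖ ≤ R → ‖f z - z‖ ≤ ε) {y : E}
    (hy : ‖y‖ ≤ R / 2) : ∃ z, ‖z‖ ≤ R ∧ f z = y := by
  have : CompleteSpace E := FiniteDimensional.complete ℂ E
  set Φ : E → E := fun z => y - (f z - z) with hΦ
  have hΦd : Differentiable ℂ Φ := by fun_prop
  set s := closedBall (0 : E) (3 * R / 4) with hs
  have hmaps : MapsTo Φ s s := by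
    intro z hz
    rw [hs, mem_closedBall_zero_iff] at hz ⊢
    have h1 := hfε z (by linarith)
    refine (norm_sub_le _ _).trans ?_
    linarith
  have hder : ∀ z ∈ s, ‖fderiv ℂ Φ z‖₊ ≤ (1 / 2 : NNReal) := by
    intro z hz
    rw [hs, mem_closedBall_zero_iff] at hz
    have h1 : fderiv ℂ Φ z = - fderiv ℂ (fun z => f z - z) z := by
      rw [hΦ, fderiv_const_sub]
    have h2 := cauchy_est (f := fun z => f z - z) (c := z) (R := R / 4) (M := ε) (by positivity)
      (by fun_prop) (fun w hw => hfε w (by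
        rw [mem_ball, dist_eq_norm] at hw
        have e : w = (w - z) + z := by abel
        rw [e]
        exact (norm_add_le _ _).trans (by linarith)))
    rw [h1, nnnorm_neg, ← NNReal.coe_le_coe, coe_nnnorm]
    refine h2.trans ?_
    rw [div_le_iff₀ (by positivity)]
    push_cast
    linarith
  have hlip : LipschitzOnWith (1 / 2 : NNReal) Φ s :=
    (convex_closedBall (0 : E) _).lipschitzOnWith_of_nnnorm_fderiv_le (𝕜 := ℂ)
      (fun z _ => hΦd z) hder
  have hctr : ContractingWith (1 / 2 : NNReal) (hmaps.restrict Φ s s) :=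
    ⟨by rw [← NNReal.coe_lt_coe]; push_cast; norm_num, hlip.mapsToRestrict hmaps⟩
  obtain ⟨z, hz, hfix, -⟩ := ContractingWith.exists_fixedPoint' isClosed_closedBall.isComplete
    hmaps hctr (x := 0) (by rw [hs, mem_closedBall_zero_iff, norm_zero]; positivity) (edist_ne_top _ _)
  rw [hs, mem_closedBall_zero_iff] at hz
  refine ⟨z, by linarith, ?_⟩
  have h1 : y - (f z - z) = z := hfix
  have h2 : y - f z = 0 := by
    have : y - f z = (y - (f z - z)) - z := by abel
    rw [this, h1, sub_self]
  exact (sub_eq_zero.1 h2).symm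

lemma final_aux [FiniteDimensional ℂ E] {Ω : Set E} (hΩ : IsOpen Ω) (hRG : RG Ω) {F G : E → E}
    {p : E} (hF : Differentiable ℂ F) (hFΩ : ∀ z, F z ∈ Ω) (hGF : ∀ z, G (F z) = z)
    (hFG : ∀ u ∈ Ω, F (G u) = u)
    (hG : DifferentiableOn ℂ G Ω) (hF0 : F 0 = p)
    (hF0' : HasFDerivAt F (ContinuousLinearMap.id ℂ E) 0) :
    ∃ ρ > (0 : ℝ), ∃ φ : ℕ → E → E, (∀ j, 1 ≤ j → IsAut (φ j) ∧ φ j p = p ∧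
          ∀ z ∈ Metric.ball p ρ,
            0.49 * ‖z - p‖ ≤ ‖φ j z - p‖ ∧ ‖φ j z - p‖ ≤ 0.51 * ‖z - p‖) ∧
        Ω = {z | Tendsto (fun j => seqComp φ j z) atTop (nhds p)} := by
  obtain ⟨R, hR, hRF⟩ : ∃ R > 0, ∀ w : E, ‖w‖ ≤ R → ‖F w - p - w‖ ≤ R / 1000 := by
    have := hF0'.isLittleO.def (show (0 : ℝ) < 1 / 1000 by norm_num)
    obtain ⟨r0, hr0, hs⟩ := Metric.eventually_nhds_iff.1 this
    refine ⟨r0 / 2, by positivity, fun w hw => ?_⟩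
    have h1 : ‖F w - p - w‖ ≤ 1 / 1000 * ‖w‖ := by
      simpa [hF0] using hs (y := w) (by rw [dist_zero_right]; linarith)
    linarith
  set ε := R / 1000 with hε
  have hε0 : 0 < ε := by positivity
  have hex : ∀ j : ℕ, ∃ χ : E → E, IsAut χ ∧ χ p = 0 ∧
      (∀ z, ‖z‖ ≤ R * 2 ^ j → ‖χ (F z) - z‖ ≤ ε) ∧ (j = 0 → ∀ w, χ w = w - p) := by
    intro j
    rcases Nat.eq_zero_or_pos j with rfl | hj
    · refine ⟨fun z => 0 + (1 : ℂ) • (z - p), isAut_affine 1 one_ne_zero 0 p, by simp,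
        fun z hz => ?_, fun _ w => by simp⟩
      simp only [zero_add, one_smul]
      exact hRF z (by simpa using hz)
    · obtain ⟨χ, h1, h2, h3⟩ := key_approx hΩ hRG hF hFΩ hGF hFG hG hF0 hF0'
        (show 0 < R * 2 ^ j by positivity) hε0
      exact ⟨χ, h1, h2, h3, fun h => absurd h hj.ne'⟩
  choose χ hχA hχp hχF hχ0 using hex
  choose σ hσA hσχ hχσ using fun j => (hχA j).exists_inv
  have hpow : ∀ j : ℕ, (1 : ℝ) ≤ 2 ^ j := fun j => one_le_pow₀ (by norm_num)
  have hsurj : ∀ j y, ‖y‖ ≤ R * 2 ^ j / 2 → ∃ z, ‖z‖ ≤ R * 2 ^ j ∧ χ j (F z) = y := by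
    intro j y hy
    refine surj_near (f := fun z => χ j (F z)) ((hχA j).1.comp hF) (by positivity)
      (ε := ε) ?_ (hχF j) hy
    have := hpow j
    rw [hε]
    nlinarith
  set φ : ℕ → E → E := fun j w => p + ((2 : ℂ) ^ j)⁻¹ •
    (χ j (σ (j - 1) (0 + (2 : ℂ) ^ (j - 1) • (w - p))) - 0) with hφ
  have hφS : ∀ n w, φ (n + 1) w = p + ((2 : ℂ) ^ (n + 1))⁻¹ •
      (χ (n + 1) (σ n ((2 : ℂ) ^ n • (w - p)))) := by
    intro n w; simp [hφ]
  have hφA : ∀ j, IsAut (φ j) := fun j =>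
    (isAut_affine (((2 : ℂ) ^ j)⁻¹) (inv_ne_zero (pow_ne_zero _ two_ne_zero)) p 0).comp
      ((hχA j).comp ((hσA (j - 1)).comp (isAut_affine ((2 : ℂ) ^ (j - 1)) (pow_ne_zero _ two_ne_zero) 0 p)))
  have hσ0 : ∀ j, σ j 0 = p := fun j => by rw [← hχp j, hσχ]
  have hφp : ∀ j, φ j p = p := by
    intro j
    simp [hφ, hσ0, hχp]
  have hseq : ∀ j w, seqComp φ j w = p + ((2 : ℂ) ^ j)⁻¹ • χ j w := by
    intro j w
    induction j with
    | zero => simp [seqComp, hχ0 0 rfl]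
    | succ n ih =>
      have : seqComp φ (n + 1) w = φ (n + 1) (seqComp φ n w) := rfl
      rw [this, ih, hφS]
      have e : (2 : ℂ) ^ n • (p + ((2 : ℂ) ^ n)⁻¹ • χ n w - p) = χ n w := by
        rw [add_sub_cancel_left, smul_smul, mul_inv_cancel₀ (pow_ne_zero _ two_ne_zero), one_smul]
      rw [e, hσχ]
  have hn2 : ∀ n : ℕ, ‖(2 : ℂ) ^ n‖ = 2 ^ n := fun n => by simp
  refine ⟨R / 2, by positivity, φ, fun j hj => ⟨hφA j, hφp j, ?_⟩, ?_⟩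
  · obtain ⟨n, rfl⟩ : ∃ n, j = n + 1 := ⟨j - 1, by omega⟩
    intro w hw
    set D : E → E := fun w => φ (n + 1) w - p - (2⁻¹ : ℂ) • (w - p) with hD
    have hDd : DifferentiableOn ℂ D (ball p (R / 2)) := by
      have := (hφA (n + 1)).1
      exact Differentiable.differentiableOn (by fun_prop)
    have hDp : D p = 0 := by simp [hD, hφp]
    have hDm : MapsTo D (ball p (R / 2)) (closedBall (D p) ε) := by
      intro w hw
      rw [mem_ball, dist_eq_norm] at hw
      rw [hDp, mem_closedBall_zero_iff]
      set y := (2 : ℂ) ^ n • (w - p) with hy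
      have hyn : ‖y‖ ≤ R * 2 ^ n / 2 := by
        rw [hy, norm_smul, hn2]
        have := hpow n
        nlinarith
      obtain ⟨z, hz, hzy⟩ := hsurj n y hyn
      have hσy : σ n y = F z := by rw [← hzy, hσχ]
      have b1 := hχF n z hz
      have b2 := hχF (n + 1) z (hz.trans (by
        have := hpow n
        rw [pow_succ]; nlinarith))
      rw [hzy] at b1
      have e : D w = ((2 : ℂ) ^ (n + 1))⁻¹ • ((χ (n + 1) (F z) - z) - (y - z)) := by
        simp only [hD, hφS, ← hy, hσy]
        have e1 : (2⁻¹ : ℂ) • (w - p) = ((2 : ℂ) ^ (n + 1))⁻¹ • y := by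
          rw [hy, smul_smul]
          congr 1
          rw [pow_succ]
          have : (2 : ℂ) ^ n ≠ 0 := pow_ne_zero _ two_ne_zero
          field_simp
        rw [e1]
        module
      rw [e, norm_smul, norm_inv, hn2, inv_mul_le_iff₀ (by positivity)]
      refine (norm_sub_le _ _).trans ?_
      have := hpow n
      rw [pow_succ]
      nlinarith
    have hsch := Complex.dist_le_div_mul_dist_of_mapsTo_ball hDd hDm hw
    rw [hDp, dist_zero_right, dist_eq_norm] at hsch
    have hq : ε / (R / 2) = 1 / 500 := by rw [hε]; field_simp; norm_num
    rw [hq] at hsch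
    have e1 : φ (n + 1) w - p = D w + (2⁻¹ : ℂ) • (w - p) := by simp only [hD]; abel
    have e2 : (2⁻¹ : ℂ) • (w - p) = (φ (n + 1) w - p) - D w := by simp only [hD]; abel
    have e3 : ‖(2⁻¹ : ℂ) • (w - p)‖ = ‖w - p‖ / 2 := by
      rw [norm_smul]; simp; ring
    have i1 := norm_add_le (D w) ((2⁻¹ : ℂ) • (w - p))
    have i2 := norm_sub_le (φ (n + 1) w - p) (D w)
    rw [← e1, e3] at i1
    rw [← e2, e3] at i2
    have := norm_nonneg (w - p)
    constructor <;> norm_num <;> linarith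
  · ext w
    rw [Set.mem_ofPred_eq]
    simp only [hseq]
    constructor
    · intro hw
      set z := G w with hz
      have hFz : F z = w := hFG w hw
      have h2 : Tendsto (fun j : ℕ => (2 : ℝ) ^ j) atTop atTop :=
        tendsto_pow_atTop_atTop_of_one_lt (by norm_num)
      have hb : ∀ᶠ j : ℕ in atTop, ‖((2 : ℂ) ^ j)⁻¹ • χ j w‖ ≤ ((2 : ℝ) ^ j)⁻¹ * (‖z‖ + ε) := by
        filter_upwards [h2.eventually_ge_atTop (‖z‖ / R)] with j hj
        rw [div_le_iff₀ hR, mul_comm] at hj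
        have h3 := hχF j z hj
        rw [hFz] at h3
        rw [norm_smul, norm_inv, hn2]
        gcongr
        have e : χ j w = z + (χ j w - z) := by abel
        rw [e]
        exact (norm_add_le _ _).trans (by linarith)
      have h0 : Tendsto (fun j : ℕ => ((2 : ℝ) ^ j)⁻¹ * (‖z‖ + ε)) atTop (𝓝 0) := by
        simpa using h2.inv_tendsto_atTop.mul_const (‖z‖ + ε)
      have := squeeze_zero_norm' hb h0
      simpa using this.const_add p
    · intro hw
      have hw' : Tendsto (fun j : ℕ => ((2 : ℂ) ^ j)⁻¹ • χ j w) atTop (𝓝 0) := by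
        simpa using hw.sub_const p
      obtain ⟨j, hj⟩ := (hw'.norm.eventually (gt_mem_nhds
        (show ‖(0 : E)‖ < R / 2 by simpa using half_pos hR))).exists
      rw [norm_smul, norm_inv, hn2, inv_mul_lt_iff₀ (by positivity)] at hj
      obtain ⟨z, -, hz⟩ := hsurj j (χ j w) (by linarith)
      have : F z = w := by
        have := congrArg (σ j) hz
        rwa [hσχ, hσχ] at this
      rw [← this]; exact hFΩ z

lemma runge_RG {k : ℕ} (hk : 2 ≤ k) {Ω : Set (EuclideanSpace ℂ (Fin k))} (hR : IsRunge Ω) :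
    RG Ω := by
  intro V hV K hKΩ hK ε hε
  have hcoord : ∀ i : Fin k, DifferentiableOn ℂ (fun z => V z i) Ω := fun i =>
    (EuclideanSpace.proj (𝕜 := ℂ) i).differentiable.comp_differentiableOn hV
  let l : Fin k → EuclideanSpace ℂ (Fin k) →L[ℂ] ℂ := fun i => EuclideanSpace.proj i
  have hε' : 0 < ε / (k + 1) := by positivity
  choose P hP using fun i => hR _ (hcoord i) K hKΩ hK (ε / (k + 1)) hε'
  refine ⟨fun z => ∑ i, MvPolynomial.eval (fun i => z i) (P i) • EuclideanSpace.single i (1 : ℂ),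
    gen_sum _ _ (fun i => ?_) (fun i => ?_), fun z hz => ?_⟩
  · have h1 := (expAp_poly l (P i)).1
    exact h1.smul continuous_const
  · have h2 := gen_poly (by simpa using hk) l (P i) (EuclideanSpace.single i (1 : ℂ))
    exact h2
  · have e : V z = ∑ i, V z i • EuclideanSpace.single i (1 : ℂ) := by
      have h := (EuclideanSpace.basisFun (Fin k) ℂ).sum_repr (V z)
      simp only [EuclideanSpace.basisFun_apply, EuclideanSpace.basisFun_repr] at h
      exact h.symm
    conv_lhs => rw [e]
    rw [← Finset.sum_sub_distrib]
    refine (norm_sum_le _ _).trans ?_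
    have : ∀ i ∈ Finset.univ, ‖MvPolynomial.eval (fun i => z i) (P i) • EuclideanSpace.single i (1 : ℂ)
        - V z i • EuclideanSpace.single i (1 : ℂ)‖ ≤ ε / (k + 1) := by
      intro i _
      rw [← sub_smul, norm_smul, norm_sub_rev]
      simpa using (hP i z hz).le
    refine (Finset.sum_le_card_nsmul _ _ _ this).trans ?_
    simp only [Finset.card_univ, Fintype.card_fin, nsmul_eq_mul]
    rw [mul_div_assoc', div_le_iff₀ (by positivity)]
    nlinarith

end P9

theorem Runge_FB_domain_is_sequence_attracting_basin (k : ℕ) (hk : 2 ≤ k)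
    (Ω : Set (EuclideanSpace ℂ (Fin k))) (hΩ : IsFBDomain Ω) (hR : IsRunge Ω)
    (p : EuclideanSpace ℂ (Fin k)) (hp : p ∈ Ω) :
    ∃ ρ > (0 : ℝ), ∃ s r : ℝ, 0 < s ∧ s < r ∧ r < 1 ∧ r ^ 2 < s ∧
      ∃ φ : ℕ → EuclideanSpace ℂ (Fin k) → EuclideanSpace ℂ (Fin k),
        (∀ j, 1 ≤ j → IsAutomorphism (φ j) ∧ φ j p = p ∧
          ∀ z ∈ Metric.ball p ρ,
            s * ‖z - p‖ ≤ ‖φ j z - p‖ ∧ ‖φ j z - p‖ ≤ r * ‖z - p‖) ∧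
        Ω = {z | Tendsto (fun j => seqComp φ j z) atTop (nhds p)} := by
  obtain ⟨ho, -, F₀, hF₀, hi₀, hr₀⟩ := hΩ
  obtain ⟨F, G, hF, hFΩ, hGF, hFG, hG, hF0, hF0'⟩ := fb_normal hF₀ hi₀ hr₀ hp
  obtain ⟨ρ, hρ, φ, hφ, hΩφ⟩ := final_aux ho (runge_RG hk hR) hF hFΩ hGF hFG hG hF0 hF0'
  exact ⟨ρ, hρ, 0.49, 0.51, by norm_num, by norm_num, by norm_num, by norm_num, φ,
    fun j hj => hφ j hj, hΩφ⟩
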